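/- arXiv:1304.0761 — 2 statements merged into one kernel-verified Lean document; each statement's English description precedes it below -/
import Mathlib

section
/- The class QRA of quasi-projective relation algebras has the superamalgamation property: for all A, B, C ∈ QRA and monomorphisms f : C → A and g : C → B there exist D ∈ QRA and monomorphisms m : A → D and n : B → D with m∘f = n∘g, and such that for all a ∈ A and b ∈ B with m(a) ≤ n(b) there exists t ∈ C with a ≤ f(t) and g(t) ≤ b. -/
universe u

/-- A relation algebra: a Boolean algebra with an associative composition `comp`,
a converse `conv` and an identity `ident` satisfying Tarski's equational axioms. -/
class RelationAlgebra (α : Type u) extends BooleanAlgebra α where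
  comp : α → α → α
  conv : α → α
  ident : α
  comp_assoc : ∀ x y z : α, comp (comp x y) z = comp x (comp y z)
  comp_ident : ∀ x : α, comp x ident = x
  ident_comp : ∀ x : α, comp ident x = x
  comp_sup : ∀ x y z : α, comp (x ⊔ y) z = comp x z ⊔ comp y z
  sup_comp : ∀ x y z : α, comp x (y ⊔ z) = comp x y ⊔ comp x z
  conv_conv : ∀ x : α, conv (conv x) = x
  conv_sup : ∀ x y : α, conv (x ⊔ y) = conv x ⊔ conv y
  conv_comp : ∀ x y : α, conv (comp x y) = comp (conv y) (conv x)
  tarski : ∀ x y : α, comp (conv x) (comp x y)ᶜ ≤ yᶜ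


/-- `α` is a quasi-projective relation algebra: there exist quasi-projections `p`, `q`
with `p̆;p ≤ 1'`, `q̆;q ≤ 1'` and `p̆;q = 1`. -/
def IsQRA (α : Type u) [RelationAlgebra α] : Prop :=
  ∃ p q : α,
    RelationAlgebra.comp (RelationAlgebra.conv p) p ≤ RelationAlgebra.ident ∧
    RelationAlgebra.comp (RelationAlgebra.conv q) q ≤ RelationAlgebra.ident ∧
    RelationAlgebra.comp (RelationAlgebra.conv p) q = ⊤

/-- A homomorphism of relation algebras. -/
def IsRAHom {α : Type u} {β : Type u} [RelationAlgebra α] [RelationAlgebra β]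
    (f : α → β) : Prop :=
  (∀ x y : α, f (x ⊔ y) = f x ⊔ f y) ∧ (∀ x : α, f xᶜ = (f x)ᶜ) ∧
  (∀ x y : α, f (RelationAlgebra.comp x y) = RelationAlgebra.comp (f x) (f y)) ∧
  (∀ x : α, f (RelationAlgebra.conv x) = RelationAlgebra.conv (f x)) ∧
  f RelationAlgebra.ident = RelationAlgebra.ident

/-- The subalgebra of a relation algebra generated by `X`. -/
inductive SgRA {α : Type u} [RelationAlgebra α] (X : Set α) : α → Prop
  | gen {x} : x ∈ X → SgRA X x
  | bot : SgRA X ⊥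
  | sup {x y} : SgRA X x → SgRA X y → SgRA X (x ⊔ y)
  | compl {x} : SgRA X x → SgRA X xᶜ
  | compP {x y} : SgRA X x → SgRA X y → SgRA X (RelationAlgebra.comp x y)
  | convP {x} : SgRA X x → SgRA X (RelationAlgebra.conv x)
  | identP : SgRA X RelationAlgebra.ident

namespace QRAProof

open RelationAlgebra

local infixl:75 " ⨾ " => RelationAlgebra.comp
local postfix:max "˘" => RelationAlgebra.conv

section Basic
variable {A : Type} [RelationAlgebra A]

lemma comp_mono {x x' y y' : A} (h : x ≤ x') (k : y ≤ y') : x ⨾ y ≤ x' ⨾ y' := by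
  have h1 : x ⨾ y ≤ x' ⨾ y := by
    rw [← sup_eq_right, ← comp_sup, sup_eq_right.2 h]
  have h2 : x' ⨾ y ≤ x' ⨾ y' := by
    rw [← sup_eq_right, ← sup_comp, sup_eq_right.2 k]
  exact h1.trans h2

lemma conv_mono {x y : A} (h : x ≤ y) : x˘ ≤ y˘ := by
  rw [← sup_eq_right, ← conv_sup, sup_eq_right.2 h]

lemma conv_le_iff {x y : A} : x˘ ≤ y ↔ x ≤ y˘ := by
  constructor
  · intro h
    have := conv_mono h
    rwa [conv_conv] at this
  · intro h
    have := conv_mono h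
    rwa [conv_conv] at this

lemma conv_inf_le (x y : A) : (x ⊓ y)˘ ≤ x˘ ⊓ y˘ :=
  le_inf (conv_mono inf_le_left) (conv_mono inf_le_right)

lemma le_conv_inf (x y : A) : x˘ ⊓ y˘ ≤ (x ⊓ y)˘ := by
  rw [← conv_le_iff]
  refine (conv_inf_le _ _).trans ?_
  rw [conv_conv, conv_conv]

lemma comp_bot (x : A) : x ⨾ (⊥ : A) = ⊥ := by
  have h1 : x ⨾ (⊥ : A) ≤ ⊤ᶜ := by
    have := tarski (x˘) (⊤ : A)
    rw [conv_conv] at this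
    refine le_trans (comp_mono le_rfl bot_le) this
  rw [compl_top] at h1
  exact le_bot_iff.1 h1

lemma modL (x y z : A) : x ⨾ y ⊓ z ≤ x ⨾ (y ⊓ x˘ ⨾ z) := by
  have h1 : x ⨾ y = x ⨾ (y ⊓ x˘ ⨾ z) ⊔ x ⨾ (y ⊓ (x˘ ⨾ z)ᶜ) := by
    rw [← sup_comp, ← inf_sup_left, sup_compl_eq_top, inf_top_eq]
  have h2 : x ⨾ (y ⊓ (x˘ ⨾ z)ᶜ) ≤ zᶜ := by
    have := tarski (x˘) z
    rw [conv_conv] at this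
    exact (comp_mono le_rfl inf_le_right).trans this
  rw [h1, inf_sup_right]
  refine sup_le inf_le_left ?_
  refine le_trans (inf_le_inf_right _ h2) ?_
  rw [compl_inf_eq_bot]
  exact bot_le

lemma modR (x y z : A) : y ⨾ x ⊓ z ≤ (y ⊓ z ⨾ x˘) ⨾ x := by
  have h := modL (x˘) (y˘) (z˘)
  rw [← conv_comp] at h
  have h2 := (le_of_eq (conv_conv _).symm).trans
    (conv_mono ((conv_inf_le (y ⨾ x) z).trans h))
  refine h2.trans ?_
  rw [conv_comp, conv_conv]
  refine comp_mono ?_ le_rfl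
  refine (conv_inf_le _ _).trans ?_
  rw [conv_conv, conv_comp, conv_conv]

lemma modL' (x y z : A) : z ⊓ x ⨾ y ≤ x ⨾ (x˘ ⨾ z ⊓ y) := by
  rw [inf_comm z, inf_comm (x˘ ⨾ z)]
  exact modL x y z

lemma func_inf {h : A} (hh : h˘ ⨾ h ≤ ident) (x y : A) : h ⨾ x ⊓ h ⨾ y ≤ h ⨾ (x ⊓ y) := by
  refine (modL h x (h ⨾ y)).trans (comp_mono le_rfl (inf_le_inf_left _ ?_))
  rw [← comp_assoc]
  refine (comp_mono hh le_rfl).trans ?_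
  rw [ident_comp]

lemma dom_inf {k r s : A} (hk : k˘ ⨾ k ≤ ident) (hr : r ≤ k) (hs : s ≤ k) :
    r ⨾ (⊤ : A) ⊓ s ⨾ (⊤ : A) ≤ (r ⊓ s) ⨾ (⊤ : A) := by
  refine (modR _ _ _).trans (comp_mono ?_ le_rfl)
  refine le_inf inf_le_left ?_
  rw [comp_assoc]
  refine (inf_le_inf_left r (comp_mono le_rfl le_top)).trans ?_
  refine (modL' s ⊤ r).trans ?_
  refine (comp_mono le_rfl (inf_le_left.trans ((comp_mono (conv_mono hs) hr).trans hk))).trans ?_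
  rw [comp_ident]

lemma dom_conv (h x k : A) : (h ⨾ x ⊓ k) ⨾ (⊤ : A) ≤ (k ⨾ x˘ ⊓ h) ⨾ (⊤ : A) := by
  refine (comp_mono (modR x h k) le_rfl).trans ?_
  rw [comp_assoc, inf_comm h]
  exact comp_mono le_rfl le_top

lemma dom_comp {h x k y l : A} (hk : k˘ ⨾ k ≤ ident) :
    (h ⨾ x ⊓ k) ⨾ (⊤ : A) ⊓ (k ⨾ y ⊓ l) ⨾ (⊤ : A) ≤ (h ⨾ (x ⨾ y) ⊓ l) ⨾ (⊤ : A) := by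
  refine (inf_le_inf_left _ (dom_conv k y l)).trans ?_
  refine (dom_inf hk inf_le_right inf_le_right).trans ?_
  have : h ⨾ x ⊓ k ⊓ (l ⨾ y˘ ⊓ k) ≤ (h ⨾ (x ⨾ y) ⊓ l) ⨾ y˘ := by
    refine (inf_le_inf inf_le_left inf_le_left).trans ?_
    rw [inf_comm (h ⨾ x)]
    refine (modR (y˘) l (h ⨾ x)).trans ?_
    rw [conv_conv, comp_assoc, inf_comm]
  refine (comp_mono this le_rfl).trans ?_
  rw [comp_assoc]
  exact comp_mono le_rfl le_top

lemma func_comp {p h : A} (hp : p˘ ⨾ p ≤ ident) (hh : h˘ ⨾ h ≤ ident) :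
    (p ⨾ h)˘ ⨾ (p ⨾ h) ≤ ident := by
  rw [conv_comp, comp_assoc, ← comp_assoc (p˘)]
  refine (comp_mono le_rfl (comp_mono hp le_rfl)).trans ?_
  rwa [ident_comp]

lemma tab {p q : A} (hpq : p˘ ⨾ q = ⊤) (r : A) : r ≤ p˘ ⨾ (p ⨾ r ⊓ q) := by
  have := modL (p˘) q r
  rw [hpq, top_inf_eq, conv_conv, inf_comm] at this
  exact this

structure UF (U : Set A) : Prop where
  up : ∀ {x y}, x ∈ U → x ≤ y → y ∈ U
  inf : ∀ {x y}, x ∈ U → y ∈ U → x ⊓ y ∈ U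
  compl : ∀ x, xᶜ ∈ U ↔ x ∉ U

lemma UF.top {U : Set A} (h : UF U) : ⊤ ∈ U := by
  by_contra hc
  exact hc (h.up ((h.compl _).2 hc) le_top)

lemma UF.bot {U : Set A} (h : UF U) : ⊥ ∉ U := by
  have := h.top
  rw [← compl_bot] at this
  exact (h.compl _).1 this

lemma UF.sup {U : Set A} (h : UF U) {x y : A} : x ⊔ y ∈ U ↔ x ∈ U ∨ y ∈ U := by
  constructor
  · intro hxy
    by_contra hc
    push Not at hc
    have := h.inf hxy (h.inf ((h.compl _).2 hc.1) ((h.compl _).2 hc.2))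
    rw [← compl_sup, inf_compl_eq_bot] at this
    exact h.bot this
  · rintro (hx | hx)
    · exact h.up hx le_sup_left
    · exact h.up hx le_sup_right

structure Fil (F : Set A) : Prop where
  up : ∀ {x y}, x ∈ F → x ≤ y → y ∈ F
  inf : ∀ {x y}, x ∈ F → y ∈ F → x ⊓ y ∈ F
  top : ⊤ ∈ F

lemma exists_UF {F : Set A} (hF : Fil F) (hb : ⊥ ∉ F) : ∃ U, UF U ∧ F ⊆ U := by
  let PF : Order.PFilter A := Order.IsPFilter.toPFilter (F := F)
    (Order.IsPFilter.of_def ⟨⊤, hF.top⟩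
      (fun x hx y hy => ⟨x ⊓ y, hF.inf hx hy, inf_le_left, inf_le_right⟩)
      (fun h hx => hF.up hx h))
  have hdis : Disjoint (PF : Set A) ((⊥ : Order.Ideal A) : Set A) := by
    rw [Set.disjoint_left]
    intro x hx hx'
    have : x = ⊥ := by
      have h3 : x ≤ ⊥ := hx'
      exact le_bot_iff.1 h3
    subst this
    exact hb hx
  obtain ⟨J, hJ, -, hd⟩ := DistribLattice.prime_ideal_of_disjoint_filter_ideal hdis
  refine ⟨(J : Set A)ᶜ, ⟨?_, ?_, ?_⟩, ?_⟩
  · intro x y hx hxy hy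
    exact hx (J.lower hxy hy)
  · intro x y hx hy hxy
    rcases hJ.mem_or_mem hxy with h | h
    · exact hx h
    · exact hy h
  · intro x
    constructor
    · intro hx hx'
      rcases hJ.mem_or_compl_mem (x := x) with h | h
      · exact hx' h
      · exact hx h
    · intro hx hx'
      have hx2 : x ∈ J := by simpa using hx
      have : x ⊔ xᶜ ∈ J := Order.Ideal.sup_mem hx2 hx'
      rw [sup_compl_eq_top] at this
      exact Set.disjoint_left.1 hd hF.top this
  · intro x hx hx'
    exact Set.disjoint_left.1 hd hx hx'

def Holds (U : Set A) (h x k : A) : Prop := (h ⨾ x ⊓ k) ⨾ (⊤ : A) ∈ U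

variable {U : Set A}

lemma holds_sup (hU : UF U) (h x y k : A) : Holds U h (x ⊔ y) k ↔ Holds U h x k ∨ Holds U h y k := by
  unfold Holds
  rw [sup_comp, inf_sup_right, comp_sup, hU.sup]

lemma holds_compl (hU : UF U) {h k : A} (hh : h˘ ⨾ h ≤ ident) (hk : k˘ ⨾ k ≤ ident)
    (th : h ⨾ (⊤ : A) ∈ U) (tk : k ⨾ (⊤ : A) ∈ U) (x : A) :
    Holds U h xᶜ k ↔ ¬ Holds U h x k := by
  constructor
  · intro h1 h2
    have h3 := hU.up (hU.inf h1 h2) (dom_inf hk inf_le_right inf_le_right)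
    refine hU.bot (hU.up h3 ?_)
    have : h ⨾ xᶜ ⊓ k ⊓ (h ⨾ x ⊓ k) ≤ ⊥ := by
      refine (inf_le_inf inf_le_left inf_le_left).trans ((func_inf hh _ _).trans ?_)
      rw [compl_inf_eq_bot, comp_bot]
    have h4 := le_bot_iff.1 this
    rw [h4]
    have h5 := tarski (⊥ : A) ((⊥ : A)˘)
    have h6 : (⊥ : A) = (⊥ : A)˘ := by
      apply le_antisymm bot_le
      rw [conv_le_iff]; exact bot_le
    rw [h6, ← conv_le_iff, conv_comp, conv_conv, comp_bot]
  · intro h1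
    have : Holds U h (x ⊔ xᶜ) k := by
      unfold Holds
      rw [sup_compl_eq_top]
      refine hU.up (hU.inf tk th) ?_
      refine (modR _ _ _).trans (comp_mono ?_ le_rfl)
      rw [inf_comm, comp_assoc]
      exact inf_le_inf_right _ (comp_mono le_rfl le_top)
    exact ((holds_sup hU _ _ _ _).1 this).resolve_left h1

lemma holds_conv (hU : UF U) (h x k : A) : Holds U h (x˘) k ↔ Holds U k x h := by
  constructor
  · intro h1
    have := hU.up h1 (dom_conv _ _ _)
    rwa [conv_conv] at this
  · intro h1
    exact hU.up h1 (dom_conv _ _ _)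

lemma holds_comp (hU : UF U) {h x k y l : A} (hk : k˘ ⨾ k ≤ ident)
    (h1 : Holds U h x k) (h2 : Holds U k y l) : Holds U h (x ⨾ y) l :=
  hU.up (hU.inf h1 h2) (dom_comp hk)

lemma holds_ident {h : A} (th : h ⨾ (⊤ : A) ∈ U) : Holds U h ident h := by
  unfold Holds
  rwa [comp_ident, inf_idem]

lemma holds_ext {U' : Set A} (hU : UF U) (hU' : UF U') {p : A} (hp : p˘ ⨾ p ≤ ident)
    (hUU : ∀ d ∈ U, p ⨾ d ∈ U') (h x k : A) :
    Holds U' (p ⨾ h) x (p ⨾ k) ↔ Holds U h x k := by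
  have key : ∀ d, p ⨾ d ∈ U' ↔ d ∈ U := by
    intro d
    refine ⟨fun h1 => ?_, hUU d⟩
    by_contra h2
    have h3 := hUU _ ((hU.compl d).2 h2)
    have h4 := hU'.up (hU'.inf h1 h3) (func_inf hp _ _)
    rw [inf_compl_eq_bot, comp_bot] at h4
    exact hU'.bot h4
  unfold Holds
  rw [← key, ← comp_assoc]
  have : p ⨾ h ⨾ x ⊓ p ⨾ k = p ⨾ (h ⨾ x ⊓ k) := by
    apply le_antisymm
    · rw [comp_assoc]; exact func_inf hp _ _
    · rw [comp_assoc]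
      exact le_inf (comp_mono le_rfl inf_le_left) (comp_mono le_rfl inf_le_right)
  rw [this]

end Basic

section Hom
variable {A B C : Type} [RelationAlgebra A] [RelationAlgebra B] [RelationAlgebra C]

lemma hom_inf {f : C → A} (hf : IsRAHom f) (x y : C) : f (x ⊓ y) = f x ⊓ f y := by
  have : x ⊓ y = (xᶜ ⊔ yᶜ)ᶜ := by simp
  rw [this, hf.2.1, hf.1, hf.2.1, hf.2.1]; simp

lemma hom_top {f : C → A} (hf : IsRAHom f) : f ⊤ = ⊤ := by
  have := hf.1 ⊤ ⊤ᶜ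
  rw [hf.2.1, sup_compl_eq_top, sup_compl_eq_top] at this
  exact this

lemma hom_bot {f : C → A} (hf : IsRAHom f) : f ⊥ = ⊥ := by
  rw [← compl_top, hf.2.1, hom_top hf, compl_top]

lemma hom_mono {f : C → A} (hf : IsRAHom f) {x y : C} (h : x ≤ y) : f x ≤ f y := by
  rw [← sup_eq_right, ← hf.1, sup_eq_right.2 h]

lemma hom_func {f : C → A} (hf : IsRAHom f) {h : C} (hh : h˘ ⨾ h ≤ ident) :
    (f h)˘ ⨾ (f h) ≤ ident := by
  have := hom_mono hf hh
  rwa [hf.2.2.1, hf.2.2.2.1, hf.2.2.2.2] at this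

lemma ext_half {f : C → A} (hf : IsRAHom f) {F : Set A} (hF : Fil F) {G : Set C} (hG : UF G)
    (hFG : ∀ t, f t ∈ F → t ∈ G) : ∃ U, UF U ∧ F ⊆ U ∧ ∀ t, f t ∈ U ↔ t ∈ G := by
  have hfil : Fil {x | ∃ a ∈ F, ∃ t ∈ G, a ⊓ f t ≤ x} := by
    refine ⟨?_, ?_, ?_⟩
    · rintro x y ⟨a, ha, t, ht, h⟩ hxy
      exact ⟨a, ha, t, ht, h.trans hxy⟩
    · rintro x y ⟨a, ha, t, ht, h⟩ ⟨a', ha', t', ht', h'⟩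
      refine ⟨a ⊓ a', hF.inf ha ha', t ⊓ t', hG.inf ht ht', ?_⟩
      rw [hom_inf hf, inf_inf_inf_comm]
      exact inf_le_inf h h'
    · exact ⟨⊤, hF.top, ⊤, hG.top, le_top⟩
  have hbt : ⊥ ∉ {x | ∃ a ∈ F, ∃ t ∈ G, a ⊓ f t ≤ x} := by
    rintro ⟨a, ha, t, ht, h⟩
    have h1 : a ≤ f tᶜ := by
      rw [hf.2.1]
      exact le_compl_iff_disjoint_right.2 (disjoint_iff_inf_le.2 h)
    exact (hG.compl t).1 (hFG _ (hF.up ha h1)) ht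
  obtain ⟨U, hU, hs⟩ := exists_UF hfil hbt
  have h1 : ∀ t ∈ G, f t ∈ U := fun t ht => hs ⟨⊤, hF.top, t, ht, inf_le_right⟩
  refine ⟨U, hU, fun x hx => hs ⟨x, hx, ⊤, hG.top, inf_le_left⟩, fun t => ⟨fun h => ?_, h1 t⟩⟩
  by_contra hc
  have := h1 _ ((hG.compl t).2 hc)
  rw [hf.2.1, hU.compl] at this
  exact this h

lemma amalg_UF {f : C → A} {g : C → B} (hf : IsRAHom f) (hg : IsRAHom g)
    {F : Set A} (hF : Fil F) {F' : Set B} (hF' : Fil F')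
    (hs : ∀ t, f t ∈ F → g tᶜ ∈ F' → False) :
    ∃ U U', UF U ∧ UF U' ∧ F ⊆ U ∧ F' ⊆ U' ∧ ∀ t, f t ∈ U ↔ g t ∈ U' := by
  have hfil : Fil {t : C | ∃ r s, f r ∈ F ∧ g s ∈ F' ∧ r ⊓ s ≤ t} := by
    refine ⟨?_, ?_, ?_⟩
    · rintro x y ⟨a, t, ha, ht, h⟩ hxy
      exact ⟨a, t, ha, ht, h.trans hxy⟩
    · rintro x y ⟨a, t, ha, ht, h⟩ ⟨a', t', ha', ht', h'⟩
      refine ⟨a ⊓ a', t ⊓ t', ?_, ?_, ?_⟩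
      · rw [hom_inf hf]; exact hF.inf ha ha'
      · rw [hom_inf hg]; exact hF'.inf ht ht'
      · rw [inf_inf_inf_comm]
        exact inf_le_inf h h'
    · refine ⟨⊤, ⊤, ?_, ?_, le_top⟩
      · rw [hom_top hf]; exact hF.top
      · rw [hom_top hg]; exact hF'.top
  have hbt : ⊥ ∉ {t : C | ∃ r s, f r ∈ F ∧ g s ∈ F' ∧ r ⊓ s ≤ t} := by
    rintro ⟨a, t, ha, ht, h⟩
    have h1 : t ≤ aᶜ := le_compl_iff_disjoint_left.2 (disjoint_iff_inf_le.2 h)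
    exact hs a ha (hF'.up ht (hom_mono hg h1))
  obtain ⟨G, hG, hGs⟩ := exists_UF hfil hbt
  obtain ⟨U, hU, h1, h2⟩ := ext_half hf hF hG
    (fun t ht => hGs ⟨t, ⊤, ht, by rw [hom_top hg]; exact hF'.top, inf_le_left⟩)
  obtain ⟨U', hU', h1', h2'⟩ := ext_half hg hF' hG
    (fun t ht => hGs ⟨⊤, t, by rw [hom_top hf]; exact hF.top, ht, inf_le_right⟩)
  exact ⟨U, U', hU, hU', h1, h1', fun t => (h2 t).trans (h2' t).symm⟩

lemma step {f : C → A} {g : C → B} (hf : IsRAHom f) (hg : IsRAHom g)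
    {U : Set A} {U' : Set B} (hU : UF U) (hU' : UF U') (hc : ∀ t, f t ∈ U ↔ g t ∈ U')
    (p : C) {d0 e : A} (hd0 : d0 ∈ U) (he : d0 ≤ (f p)˘ ⨾ e) :
    ∃ V V', UF V ∧ UF V' ∧ (∀ t, f t ∈ V ↔ g t ∈ V') ∧ e ∈ V ∧
      (∀ d ∈ U, f p ⨾ d ∈ V) ∧ (∀ d ∈ U', g p ⨾ d ∈ V') := by
  have hfil : Fil {x | ∃ d ∈ U, f p ⨾ d ⊓ e ≤ x} := by
    refine ⟨?_, ?_, ?_⟩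
    · rintro x y ⟨d, hd, h⟩ hxy
      exact ⟨d, hd, h.trans hxy⟩
    · rintro x y ⟨d, hd, h⟩ ⟨d', hd', h'⟩
      refine ⟨d ⊓ d', hU.inf hd hd', le_inf ?_ ?_⟩
      · exact (inf_le_inf_right _ (comp_mono le_rfl inf_le_left)).trans h
      · exact (inf_le_inf_right _ (comp_mono le_rfl inf_le_right)).trans h'
    · exact ⟨⊤, hU.top, le_top⟩
  have hfil' : Fil {x | ∃ d ∈ U', g p ⨾ d ≤ x} := by
    refine ⟨?_, ?_, ?_⟩
    · rintro x y ⟨d, hd, h⟩ hxy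
      exact ⟨d, hd, h.trans hxy⟩
    · rintro x y ⟨d, hd, h⟩ ⟨d', hd', h'⟩
      refine ⟨d ⊓ d', hU'.inf hd hd', le_inf ?_ ?_⟩
      · exact (comp_mono le_rfl inf_le_left).trans h
      · exact (comp_mono le_rfl inf_le_right).trans h'
    · exact ⟨⊤, hU'.top, le_top⟩
  have hsep : ∀ t, f t ∈ {x | ∃ d ∈ U, f p ⨾ d ⊓ e ≤ x} →
      g tᶜ ∈ {x | ∃ d ∈ U', g p ⨾ d ≤ x} → False := by
    rintro t ⟨d, hd, h⟩ ⟨d', hd', h'⟩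
    have h1 : f (p˘ ⨾ t) ∈ U := by
      refine hU.up (hU.inf hd0 hd) ?_
      refine (inf_le_inf_right _ he).trans ((modL _ _ _).trans ?_)
      rw [hf.2.2.1, hf.2.2.2.1, conv_conv, inf_comm]
      exact comp_mono le_rfl h
    have h2 := hU'.inf ((hc _).1 h1) hd'
    refine hU'.bot (hU'.up h2 ?_)
    rw [hg.2.2.1, hg.2.2.2.1]
    refine (modL _ _ _).trans ?_
    rw [conv_conv]
    refine (comp_mono le_rfl (inf_le_inf_left _ h')).trans ?_
    rw [hg.2.1, inf_compl_eq_bot, comp_bot]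
  obtain ⟨V, V', hV, hV', h1, h2, h3⟩ := amalg_UF hf hg hfil hfil' hsep
  exact ⟨V, V', hV, hV', h3, h1 ⟨⊤, hU.top, inf_le_right⟩, fun d hd => h1 ⟨d, hd, inf_le_left⟩,
    fun d hd => h2 ⟨d, hd, le_rfl⟩⟩

/-- one witness step -/
lemma witness {f : C → A} {g : C → B} (hf : IsRAHom f) (hg : IsRAHom g)
    {U : Set A} {U' : Set B} (hU : UF U) (hU' : UF U') (hc : ∀ t, f t ∈ U ↔ g t ∈ U')
    {p q : C} (hpq : p˘ ⨾ q = ⊤)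
    {h l : C} {x y : A} (hxy : Holds U (f h) (x ⨾ y) (f l)) :
    ∃ V V', UF V ∧ UF V' ∧ (∀ t, f t ∈ V ↔ g t ∈ V') ∧
      f q ⨾ ⊤ ∈ V ∧ Holds V (f (p ⨾ h)) x (f q) ∧ Holds V (f q) y (f (p ⨾ l)) ∧
      (∀ d ∈ U, f p ⨾ d ∈ V) ∧ (∀ d ∈ U', g p ⨾ d ∈ V') := by
  have hpq' : (f p)˘ ⨾ f q = ⊤ := by
    rw [← hf.2.2.2.1, ← hf.2.2.1, hpq, hom_top hf]
  obtain ⟨V, V', hV, hV', h1, h2, h3, h4⟩ := step hf hg hU hU' hc p (d0 := _)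
    (e := (f p ⨾ (f h ⨾ x ⊓ f l ⨾ y˘) ⊓ f q) ⨾ ⊤) hxy (by
      rw [← comp_assoc ((f p)˘)]
      refine le_trans ?_ (comp_mono (tab hpq' (f h ⨾ x ⊓ f l ⨾ y˘)) (le_refl (⊤ : A)))
      rw [← comp_assoc]
      refine (comp_mono (modR _ _ _) le_rfl).trans ?_
      rw [comp_assoc]
      exact comp_mono le_rfl le_top)
  refine ⟨V, V', hV, hV', h1, ?_, ?_, ?_, h3, h4⟩
  · exact hV.up h2 (comp_mono inf_le_right le_rfl)
  · refine hV.up h2 (comp_mono (inf_le_inf_right _ ?_) le_rfl)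
    rw [hf.2.2.1, comp_assoc]
    exact comp_mono le_rfl inf_le_left
  · rw [← holds_conv hV]
    refine hV.up h2 (comp_mono (inf_le_inf_right _ ?_) le_rfl)
    rw [hf.2.2.1, comp_assoc]
    exact comp_mono le_rfl inf_le_right

end Hom

inductive T (A B : Type) : Type
  | b0 : T A B
  | b1 : T A B
  | wa (x y : A) (u w : T A B) : T A B
  | wb (x y : B) (u w : T A B) : T A B

structure Loc {A V : Type} [RelationAlgebra A] (R : A → V → V → Prop) (S : Set V) : Prop where
  sup : ∀ x y, ∀ u ∈ S, ∀ v ∈ S, (R (x ⊔ y) u v ↔ R x u v ∨ R y u v)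
  compl : ∀ x, ∀ u ∈ S, ∀ v ∈ S, (R xᶜ u v ↔ ¬ R x u v)
  conv : ∀ x, ∀ u ∈ S, ∀ v ∈ S, (R (x˘) u v ↔ R x v u)
  comp : ∀ x y, ∀ u ∈ S, ∀ v ∈ S, ∀ w ∈ S, R x u v → R y v w → R (x ⨾ y) u w
  ident : ∀ u ∈ S, R RelationAlgebra.ident u u

section Main
variable {A B C : Type} [RelationAlgebra A] [RelationAlgebra B] [RelationAlgebra C]

structure Wit (a : A) (b : B) (S : Set (T A B)) (M : A → T A B → T A B → Prop)
    (N : B → T A B → T A B → Prop) : Prop where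
  m0 : T.b0 ∈ S
  m1 : T.b1 ∈ S
  ha : M a T.b0 T.b1
  hb : ¬ N b T.b0 T.b1
  wa : ∀ x y u w, T.wa x y u w ∈ S → u ∈ S ∧ w ∈ S ∧
    (M (x ⨾ y) u w → M x u (T.wa x y u w) ∧ M y (T.wa x y u w) w)
  wb : ∀ x y u w, T.wb x y u w ∈ S → u ∈ S ∧ w ∈ S ∧
    (N (x ⨾ y) u w → N x u (T.wb x y u w) ∧ N y (T.wb x y u w) w)

lemma Wit.ext {a : A} {b : B} {S : Set (T A B)} {M M' : A → T A B → T A B → Prop}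
    {N N' : B → T A B → T A B → Prop} (h : Wit a b S M N)
    (hM : ∀ x, ∀ u ∈ S, ∀ v ∈ S, (M' x u v ↔ M x u v))
    (hN : ∀ x, ∀ u ∈ S, ∀ v ∈ S, (N' x u v ↔ N x u v)) (v : T A B)
    (h1 : ∀ x y u w, v = T.wa x y u w → u ∈ S ∧ w ∈ S ∧ (M' (x ⨾ y) u w → M' x u v ∧ M' y v w))
    (h2 : ∀ x y u w, v = T.wb x y u w → u ∈ S ∧ w ∈ S ∧ (N' (x ⨾ y) u w → N' x u v ∧ N' y v w)) :
    Wit a b (insert v S) M' N' := by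
  refine ⟨Or.inr h.m0, Or.inr h.m1, (hM _ _ h.m0 _ h.m1).2 h.ha,
    fun hc => h.hb ((hN _ _ h.m0 _ h.m1).1 hc), ?_, ?_⟩
  · rintro x y u w (hv | hv)
    · obtain ⟨i, j, k⟩ := h1 x y u w hv.symm
      rw [hv]
      exact ⟨Or.inr i, Or.inr j, k⟩
    · obtain ⟨i, j, k⟩ := h.wa x y u w hv
      refine ⟨Or.inr i, Or.inr j, ?_⟩
      rw [hM _ _ i _ j, hM _ _ i _ hv, hM _ _ hv _ j]
      exact k
  · rintro x y u w (hv | hv)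
    · obtain ⟨i, j, k⟩ := h2 x y u w hv.symm
      rw [hv]
      exact ⟨Or.inr i, Or.inr j, k⟩
    · obtain ⟨i, j, k⟩ := h.wb x y u w hv
      refine ⟨Or.inr i, Or.inr j, ?_⟩
      rw [hN _ _ i _ j, hN _ _ i _ hv, hN _ _ hv _ j]
      exact k

structure Good {X : Type} (f : C → A) (g : C → B) (S : Set X) (U : Set A) (U' : Set B)
    (h : X → C) : Prop where
  uf : UF U
  uf' : UF U'
  coh : ∀ t, f t ∈ U ↔ g t ∈ U'
  func : ∀ v ∈ S, (h v)˘ ⨾ h v ≤ ident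
  tot : ∀ v ∈ S, f (h v ⨾ ⊤) ∈ U

def Rl {X : Type} (f : C → A) (U : Set A) (h : X → C) : A → X → X → Prop :=
  fun x u v => Holds U (f (h u)) x (f (h v))

lemma loc_of {X : Type} {f : C → A} (hf : IsRAHom f) {S : Set X} {U : Set A} (hU : UF U)
    {h : X → C} (func : ∀ v ∈ S, (h v)˘ ⨾ h v ≤ ident) (tot : ∀ v ∈ S, f (h v ⨾ ⊤) ∈ U) :
    Loc (Rl f U h) S := by
  have tot' : ∀ v ∈ S, f (h v) ⨾ ⊤ ∈ U := by
    intro v hv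
    have := tot v hv
    rwa [hf.2.2.1, hom_top hf] at this
  refine ⟨?_, ?_, ?_, ?_, ?_⟩
  · intro x y u _ v _
    exact holds_sup hU _ _ _ _
  · intro x u hu v hv
    exact holds_compl hU (hom_func hf (func u hu)) (hom_func hf (func v hv)) (tot' u hu) (tot' v hv) x
  · intro x u _ v _
    exact holds_conv hU _ _ _
  · intro x y u _ v hv w _ h1 h2
    exact holds_comp hU (hom_func hf (func v hv)) h1 h2
  · intro u hu
    exact holds_ident (tot' u hu)

lemma Good.agree {X : Type} {f : C → A} {g : C → B} (hf : IsRAHom f) (hg : IsRAHom g)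
    {S : Set X} {U : Set A} {U' : Set B}
    {h : X → C} (G : Good f g S U U' h) (c : C) (u v : X) : Rl f U h (f c) u v ↔ Rl g U' h (g c) u v := by
  have := G.coh ((h u ⨾ c ⊓ h v) ⨾ ⊤)
  rw [hf.2.2.1, hom_inf hf, hf.2.2.1, hom_top hf, hg.2.2.1, hom_inf hg, hg.2.2.1, hom_top hg] at this
  exact this

open Classical in
lemma Good.add {X : Type} {f : C → A} {g : C → B} (hf : IsRAHom f) (hg : IsRAHom g)
    {S : Set X} {U : Set A} {U' : Set B}
    {h : X → C} (G : Good f g S U U' h) {p q : C} (hp : p˘ ⨾ p ≤ ident) (hq : q˘ ⨾ q ≤ ident)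
    {V : Set A} {V' : Set B} (hV : UF V) (hV' : UF V') (coh : ∀ t, f t ∈ V ↔ g t ∈ V')
    (hqV : f (q ⨾ ⊤) ∈ V) (e : ∀ d ∈ U, f p ⨾ d ∈ V) (e' : ∀ d ∈ U', g p ⨾ d ∈ V') {v : X}
    (hv : v ∉ S) :
    Good f g (insert v S) V V' (Function.update (fun z => p ⨾ h z) v q) ∧
    (∀ x, ∀ u ∈ S, ∀ w ∈ S, (Rl f V (Function.update (fun z => p ⨾ h z) v q) x u w ↔ Rl f U h x u w)) ∧
    (∀ x, ∀ u ∈ S, ∀ w ∈ S, (Rl g V' (Function.update (fun z => p ⨾ h z) v q) x u w ↔ Rl g U' h x u w)) := by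
  have hne : ∀ u ∈ S, u ≠ v := fun u hu huv => hv (huv ▸ hu)
  refine ⟨⟨hV, hV', coh, ?_, ?_⟩, ?_, ?_⟩
  · rintro u (rfl | hu)
    · rwa [Function.update_self]
    · rw [Function.update_of_ne (hne u hu)]
      exact func_comp hp (G.func u hu)
  · rintro u (rfl | hu)
    · rwa [Function.update_self]
    · rw [Function.update_of_ne (hne u hu), comp_assoc, hf.2.2.1]
      exact e _ (G.tot u hu)
  · intro x u hu w hw
    unfold Rl
    rw [Function.update_of_ne (hne u hu), Function.update_of_ne (hne w hw), hf.2.2.1, hf.2.2.1]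
    exact holds_ext G.uf hV (hom_func hf hp) e _ _ _
  · intro x u hu w hw
    unfold Rl
    rw [Function.update_of_ne (hne u hu), Function.update_of_ne (hne w hw), hg.2.2.1, hg.2.2.1]
    exact holds_ext G.uf' hV' (hom_func hg hp) e' _ _ _

open Classical in
lemma Good.dup {X : Type} {f : C → A} {g : C → B}
    {S : Set X} {U : Set A} {U' : Set B}
    {h : X → C} (G : Good f g S U U' h) {v u0 : X}
    (hv : v ∉ S) (hu0 : u0 ∈ S) :
    Good f g (insert v S) U U' (Function.update h v (h u0)) ∧
    (∀ x, ∀ u ∈ S, ∀ w ∈ S, (Rl f U (Function.update h v (h u0)) x u w ↔ Rl f U h x u w)) ∧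
    (∀ x, ∀ u ∈ S, ∀ w ∈ S, (Rl g U' (Function.update h v (h u0)) x u w ↔ Rl g U' h x u w)) := by
  have hne : ∀ u ∈ S, u ≠ v := fun u hu huv => hv (huv ▸ hu)
  refine ⟨⟨G.uf, G.uf', G.coh, ?_, ?_⟩, ?_, ?_⟩
  · rintro u (rfl | hu)
    · rw [Function.update_self]; exact G.func _ hu0
    · rw [Function.update_of_ne (hne u hu)]
      exact G.func u hu
  · rintro u (rfl | hu)
    · rw [Function.update_self]; exact G.tot _ hu0
    · rw [Function.update_of_ne (hne u hu)]
      exact G.tot u hu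
  · intro x u hu w hw
    unfold Rl
    rw [Function.update_of_ne (hne u hu), Function.update_of_ne (hne w hw)]
  · intro x u hu w hw
    unfold Rl
    rw [Function.update_of_ne (hne u hu), Function.update_of_ne (hne w hw)]

def P (f : C → A) (g : C → B) (a : A) (b : B) (S : Set (T A B)) : Prop :=
  ∃ U U' h, Good f g S U U' h ∧ Wit a b S (Rl f U h) (Rl g U' h)

open Classical in
lemma P.ext {f : C → A} {g : C → B} (hf : IsRAHom f) (hg : IsRAHom g) {p q : C}
    (hp : p˘ ⨾ p ≤ ident) (hq : q˘ ⨾ q ≤ ident) (hpq : p˘ ⨾ q = ⊤) {a : A} {b : B}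
    (v : T A B) : ∀ S, P f g a b S → ∃ S', S ⊆ S' ∧ v ∈ S' ∧ P f g a b S' := by
  induction v with
  | b0 =>
    rintro S ⟨U, U', h, G, W⟩
    exact ⟨S, subset_rfl, W.m0, U, U', h, G, W⟩
  | b1 =>
    rintro S ⟨U, U', h, G, W⟩
    exact ⟨S, subset_rfl, W.m1, U, U', h, G, W⟩
  | wa x y u w ihu ihw =>
    intro S0 hS0
    obtain ⟨S1, h01, hu, hS1⟩ := ihu S0 hS0
    obtain ⟨S, h12, hw, hS⟩ := ihw S1 hS1
    replace hu := h12 hu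
    have h02 := h01.trans h12
    by_cases hv : T.wa x y u w ∈ S
    · exact ⟨S, h02, hv, hS⟩
    refine ⟨insert (T.wa x y u w) S, h02.trans (Set.subset_insert _ _), Or.inl rfl, ?_⟩
    obtain ⟨U, U', h, G, W⟩ := hS
    have hne : ∀ z ∈ S, z ≠ T.wa x y u w := fun z hz hzv => hv (hzv ▸ hz)
    by_cases hh : Rl f U h (x ⨾ y) u w
    · obtain ⟨V, V', hV, hV', coh, e1, e2, e3, e4, e5⟩ :=
        witness hf hg G.uf G.uf' G.coh hpq hh
      obtain ⟨G', a1, a2⟩ := G.add hf hg hp hq hV hV' coh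
        (by rw [hf.2.2.1, hom_top hf]; exact e1) e4 e5 hv
      refine ⟨_, _, _, G', W.ext a1 a2 _ ?_ ?_⟩
      · rintro x' y' u' w' hx
        injection hx with i1 i2 i3 i4
        subst i1 i2 i3 i4
        refine ⟨hu, hw, fun _ => ?_⟩
        unfold Rl
        rw [Function.update_self, Function.update_of_ne (hne _ hu), Function.update_of_ne (hne _ hw)]
        exact ⟨e2, e3⟩
      · rintro x' y' u' w' hx
        cases hx
    · obtain ⟨G', a1, a2⟩ := G.dup hv hu
      refine ⟨_, _, _, G', W.ext a1 a2 _ ?_ ?_⟩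
      · rintro x' y' u' w' hx
        injection hx with i1 i2 i3 i4
        subst i1 i2 i3 i4
        refine ⟨hu, hw, fun hc => ?_⟩
        exact absurd ((a1 _ _ hu _ hw).1 hc) hh
      · rintro x' y' u' w' hx
        cases hx
  | wb x y u w ihu ihw =>
    intro S0 hS0
    obtain ⟨S1, h01, hu, hS1⟩ := ihu S0 hS0
    obtain ⟨S, h12, hw, hS⟩ := ihw S1 hS1
    replace hu := h12 hu
    have h02 := h01.trans h12
    by_cases hv : T.wb x y u w ∈ S
    · exact ⟨S, h02, hv, hS⟩
    refine ⟨insert (T.wb x y u w) S, h02.trans (Set.subset_insert _ _), Or.inl rfl, ?_⟩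
    obtain ⟨U, U', h, G, W⟩ := hS
    have hne : ∀ z ∈ S, z ≠ T.wb x y u w := fun z hz hzv => hv (hzv ▸ hz)
    by_cases hh : Rl g U' h (x ⨾ y) u w
    · obtain ⟨V', V, hV', hV, coh, e1, e2, e3, e4, e5⟩ :=
        witness hg hf G.uf' G.uf (fun t => (G.coh t).symm) hpq hh
      obtain ⟨G', a1, a2⟩ := G.add hf hg hp hq hV hV' (fun t => (coh t).symm)
        (by rw [← coh, hg.2.2.1, hom_top hg]; exact e1) e5 e4 hv
      refine ⟨_, _, _, G', W.ext a1 a2 _ ?_ ?_⟩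
      · rintro x' y' u' w' hx
        cases hx
      · rintro x' y' u' w' hx
        injection hx with i1 i2 i3 i4
        subst i1 i2 i3 i4
        refine ⟨hu, hw, fun _ => ?_⟩
        unfold Rl
        rw [Function.update_self, Function.update_of_ne (hne _ hu), Function.update_of_ne (hne _ hw)]
        exact ⟨e2, e3⟩
    · obtain ⟨G', a1, a2⟩ := G.dup hv hu
      refine ⟨_, _, _, G', W.ext a1 a2 _ ?_ ?_⟩
      · rintro x' y' u' w' hx
        cases hx
      · rintro x' y' u' w' hx
        injection hx with i1 i2 i3 i4
        subst i1 i2 i3 i4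
        refine ⟨hu, hw, fun hc => ?_⟩
        exact absurd ((a2 _ _ hu _ hw).1 hc) hh

lemma fil_principal (e : A) : Fil {x | e ≤ x} :=
  ⟨fun h h' => le_trans h h', fun h h' => le_inf h h', le_top⟩

lemma P.init {f : C → A} {g : C → B} (hf : IsRAHom f) (hg : IsRAHom g) {p q : C}
    (hp : p˘ ⨾ p ≤ ident) (hq : q˘ ⨾ q ≤ ident) (hpq : p˘ ⨾ q = ⊤) {a : A} {b : B}
    (hab : ¬ ∃ t : C, a ≤ f t ∧ g t ≤ b) : P f g a b {T.b0, T.b1} := by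
  have hpq' : (f p)˘ ⨾ f q = ⊤ := by
    rw [← hf.2.2.2.1, ← hf.2.2.1, hpq, hom_top hf]
  have hsep : ∀ t, f t ∈ {x | (f p ⨾ a ⊓ f q) ⨾ ⊤ ≤ x} →
      g tᶜ ∈ {x | (g p ⨾ bᶜ ⊓ g q) ⨾ ⊤ ≤ x} → False := by
    intro t h1 h2
    have le_dom : ∀ {X : Type} [RelationAlgebra X] (z : X), z ≤ z ⨾ ⊤ := by
      intro X _ z
      refine (le_of_eq (comp_ident z).symm).trans (comp_mono le_rfl le_top)
    refine hab ⟨p˘ ⨾ (t ⊓ q), ?_, ?_⟩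
    · refine (tab hpq' a).trans ?_
      rw [hf.2.2.1, hf.2.2.2.1, hom_inf hf]
      exact comp_mono le_rfl (le_inf ((le_dom _).trans h1) inf_le_right)
    · rw [← compl_compl b, le_compl_iff_disjoint_right, disjoint_iff_inf_le]
      rw [hg.2.2.1, hg.2.2.2.1, hom_inf hg]
      refine (modL _ _ _).trans ?_
      rw [conv_conv]
      have h3 : g t ⊓ g q ⊓ g p ⨾ bᶜ ≤ ⊥ := by
        have h4 : g q ⊓ g p ⨾ bᶜ ≤ g tᶜ := by
          rw [inf_comm]; exact (le_dom _).trans h2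
        rw [inf_assoc]
        refine (inf_le_inf_left _ h4).trans ?_
        rw [hg.2.1, inf_compl_eq_bot]
      refine (comp_mono le_rfl h3).trans ?_
      rw [comp_bot]
  obtain ⟨U, U', hU, hU', h1, h2, h3⟩ := amalg_UF hf hg (fil_principal _) (fil_principal _) hsep
  have e1 : Holds U (f p) a (f q) := h1 (le_refl _)
  have e2 : Holds U' (g p) bᶜ (g q) := h2 (le_refl _)
  let h : T A B → C := fun v => match v with
    | T.b0 => p
    | _ => q
  have G : Good f g {T.b0, T.b1} U U' h := by
    refine ⟨hU, hU', h3, ?_, ?_⟩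
    · rintro v (rfl | rfl)
      · exact hp
      · exact hq
    · have tp : f p ⨾ ⊤ ∈ U := by
        refine hU.up e1 ((dom_conv _ _ _).trans (comp_mono inf_le_right le_rfl))
      have tq : f q ⨾ ⊤ ∈ U := by
        refine hU.up e1 (comp_mono inf_le_right le_rfl)
      rintro v (rfl | rfl)
      · rw [hf.2.2.1, hom_top hf]; exact tp
      · rw [hf.2.2.1, hom_top hf]; exact tq
  have L := loc_of hg G.uf' G.func (fun v hv => (G.coh _).1 (G.tot v hv))
  refine ⟨U, U', h, G, Or.inl rfl, Or.inr rfl, e1, ?_, ?_, ?_⟩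
  · exact (L.compl b _ (Or.inl rfl) _ (Or.inr rfl)).1 e2
  · rintro x y u w (hc | hc) <;> cases hc
  · rintro x y u w (hc | hc) <;> cases hc

lemma limit_loc {X : Type} (F : Ultrafilter (Finset X)) (hF : (F : Filter (Finset X)) ≤ Filter.atTop)
    (R : Finset X → A → X → X → Prop) (S : Finset X → Set X) (hS : ∀ s : Finset X, (s : Set X) ⊆ S s)
    (hL : ∀ s, Loc (R s) (S s)) :
    Loc (fun x u v => ∀ᶠ s in (F : Filter (Finset X)), R s x u v) Set.univ := by
  have mem : ∀ u : X, ∀ᶠ s in (F : Filter (Finset X)), u ∈ S s := by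
    intro u
    refine hF ?_
    filter_upwards [Filter.eventually_ge_atTop {u}] with s hs
    exact hS s (hs (by simp))
  refine ⟨?_, ?_, ?_, ?_, ?_⟩
  · intro x y u _ v _
    rw [← Ultrafilter.eventually_or]
    apply Filter.eventually_congr
    filter_upwards [mem u, mem v] with s hu hv
    exact (hL s).sup x y u hu v hv
  · intro x u _ v _
    rw [← Ultrafilter.eventually_not]
    apply Filter.eventually_congr
    filter_upwards [mem u, mem v] with s hu hv
    exact (hL s).compl x u hu v hv
  · intro x u _ v _
    apply Filter.eventually_congr
    filter_upwards [mem u, mem v] with s hu hv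
    exact (hL s).conv x u hu v hv
  · intro x y u _ v _ w _ h1 h2
    filter_upwards [mem u, mem v, mem w, h1, h2] with s hu hv hw h1 h2
    exact (hL s).comp x y u hu v hv w hw h1 h2
  · intro u _
    filter_upwards [mem u] with s hu
    exact (hL s).ident u hu

lemma joint {f : C → A} {g : C → B} (hf : IsRAHom f) (hg : IsRAHom g) {p q : C}
    (hp : p˘ ⨾ p ≤ ident) (hq : q˘ ⨾ q ≤ ident) (hpq : p˘ ⨾ q = ⊤) {a : A} {b : B}
    (hab : ¬ ∃ t : C, a ≤ f t ∧ g t ≤ b) :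
    ∃ (M : A → T A B → T A B → Prop) (N : B → T A B → T A B → Prop),
      Loc M Set.univ ∧ Loc N Set.univ ∧ (∀ c u v, M (f c) u v ↔ N (g c) u v) ∧
      Wit a b Set.univ M N := by
  classical
  have key : ∀ s : Finset (T A B), ∃ S : Set (T A B), (s : Set (T A B)) ⊆ S ∧ P f g a b S := by
    intro s
    induction s using Finset.induction_on with
    | empty => exact ⟨_, by simp, P.init hf hg hp hq hpq hab⟩
    | insert v s _ ih =>
      obtain ⟨S, h1, h2⟩ := ih
      obtain ⟨S', h3, h4, h5⟩ := P.ext hf hg hp hq hpq v S h2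
      refine ⟨S', ?_, h5⟩
      rw [Finset.coe_insert]
      exact Set.insert_subset h4 (h1.trans h3)
  choose S hS U U' h G W using key
  let F : Ultrafilter (Finset (T A B)) := Ultrafilter.of Filter.atTop
  have hF : (F : Filter (Finset (T A B))) ≤ Filter.atTop := Ultrafilter.of_le _
  have mem : ∀ u : T A B, ∀ᶠ s in (F : Filter (Finset (T A B))), u ∈ S s := by
    intro u
    refine hF ?_
    filter_upwards [Filter.eventually_ge_atTop {u}] with s hs
    exact hS s (hs (by simp))
  refine ⟨fun x u v => ∀ᶠ s in (F : Filter _), Rl f (U s) (h s) x u v,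
    fun x u v => ∀ᶠ s in (F : Filter _), Rl g (U' s) (h s) x u v, ?_, ?_, ?_, ?_⟩
  · exact limit_loc F hF (fun s => Rl f (U s) (h s)) S hS
      (fun s => loc_of hf (G s).uf (G s).func (G s).tot)
  · exact limit_loc F hF (fun s => Rl g (U' s) (h s)) S hS
      (fun s => loc_of hg (G s).uf' (G s).func (fun v hv => ((G s).coh _).1 ((G s).tot v hv)))
  · intro c u v
    apply Filter.eventually_congr
    exact Filter.Eventually.of_forall (fun s => (G s).agree hf hg c u v)
  · refine ⟨trivial, trivial, ?_, ?_, ?_, ?_⟩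
    · exact Filter.Eventually.of_forall (fun s => (W s).ha)
    · rw [← Ultrafilter.eventually_not]
      exact Filter.Eventually.of_forall (fun s => (W s).hb)
    · intro x y u w _
      refine ⟨trivial, trivial, fun hc => ?_⟩
      rw [← Filter.eventually_and]
      filter_upwards [hc, mem (T.wa x y u w)] with s h1 h2
      exact ((W s).wa x y u w h2).2.2 h1
    · intro x y u w _
      refine ⟨trivial, trivial, fun hc => ?_⟩
      rw [← Filter.eventually_and]
      filter_upwards [hc, mem (T.wb x y u w)] with s h1 h2
      exact ((W s).wb x y u w h2).2.2 h1

end Main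

/-- full relation algebra, product version -/
@[reducible] def relPi {I : Type} (U : I → Type) : RelationAlgebra (∀ i, U i → U i → Prop) where
  comp r s := fun i x z => ∃ y, r i x y ∧ s i y z
  conv r := fun i x y => r i y x
  ident := fun i x y => x = y
  comp_assoc r s t := by
    funext i x y; apply propext
    constructor
    · rintro ⟨z, ⟨w, h1, h2⟩, h3⟩
      exact ⟨w, h1, z, h2, h3⟩
    · rintro ⟨w, h1, z, h2, h3⟩
      exact ⟨z, ⟨w, h1, h2⟩, h3⟩
  comp_ident r := by
    funext i x y; apply propext
    constructor
    · rintro ⟨z, h, rfl⟩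
      exact h
    · intro h
      exact ⟨y, h, rfl⟩
  ident_comp r := by
    funext i x y; apply propext
    constructor
    · rintro ⟨z, rfl, h⟩
      exact h
    · intro h
      exact ⟨x, rfl, h⟩
  comp_sup r s t := by
    funext i x y; apply propext
    constructor
    · rintro ⟨z, h | h, k⟩
      · exact Or.inl ⟨z, h, k⟩
      · exact Or.inr ⟨z, h, k⟩
    · rintro (⟨z, h, k⟩ | ⟨z, h, k⟩)
      · exact ⟨z, Or.inl h, k⟩
      · exact ⟨z, Or.inr h, k⟩
  sup_comp r s t := by
    funext i x y; apply propext
    constructor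
    · rintro ⟨z, k, h | h⟩
      · exact Or.inl ⟨z, k, h⟩
      · exact Or.inr ⟨z, k, h⟩
    · rintro (⟨z, k, h⟩ | ⟨z, k, h⟩)
      · exact ⟨z, k, Or.inl h⟩
      · exact ⟨z, k, Or.inr h⟩
  conv_conv r := rfl
  conv_sup r s := rfl
  conv_comp r s := by
    funext i x y; apply propext
    constructor
    · rintro ⟨z, h, k⟩
      exact ⟨z, k, h⟩
    · rintro ⟨z, h, k⟩
      exact ⟨z, k, h⟩
  tarski r s := by
    rintro i x y ⟨z, h, k⟩ hs
    exact k ⟨x, h, hs⟩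

structure Rep {A X : Type} [RelationAlgebra A] (R : A → X → X → Prop) : Prop where
  sup : ∀ x y u v, (R (x ⊔ y) u v ↔ R x u v ∨ R y u v)
  compl : ∀ x u v, (R xᶜ u v ↔ ¬ R x u v)
  conv : ∀ x u v, (R (x˘) u v ↔ R x v u)
  comp : ∀ x y u w, (R (x ⨾ y) u w ↔ ∃ v, R x u v ∧ R y v w)
  ident : ∀ u v, R RelationAlgebra.ident u v ↔ u = v

lemma hom_of_rep {A : Type} [RelationAlgebra A] {I : Type} (U : I → Type)
    (R : ∀ i, A → U i → U i → Prop) (hR : ∀ i, Rep (R i)) :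
    @IsRAHom A (∀ i, U i → U i → Prop) _ (relPi U) (fun x i => R i x) := by
  refine ⟨?_, ?_, ?_, ?_, ?_⟩
  · intro x y
    funext i u v
    exact propext ((hR i).sup x y u v)
  · intro x
    funext i u v
    exact propext ((hR i).compl x u v)
  · intro x y
    funext i u v
    exact propext ((hR i).comp x y u v)
  · intro x
    funext i u v
    exact propext ((hR i).conv x u v)
  · funext i u v
    exact propext ((hR i).ident u v)

section Quot
variable {A X : Type} [RelationAlgebra A]

lemma conv_ident : (ident : A)˘ = ident := by
  have h := conv_comp ((ident : A)˘) ident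
  rw [comp_ident, conv_conv, comp_ident] at h
  exact h.symm

lemma loc_inv {R : A → X → X → Prop} (L : Loc R Set.univ) {x : A} {u u' v v' : X}
    (hu : R ident u' u) (hv : R ident v v') (h : R x u v) : R x u' v' := by
  have h1 := L.comp _ _ u' trivial u trivial v trivial hu h
  rw [ident_comp] at h1
  have h2 := L.comp _ _ u' trivial v trivial v' trivial h1 hv
  rwa [comp_ident] at h2

lemma loc_symm {R : A → X → X → Prop} (L : Loc R Set.univ) {u v : X}
    (h : R ident u v) : R ident v u := by
  rw [← conv_ident, L.conv _ _ trivial _ trivial]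
  exact h

def lq (s : Setoid X) (R : A → X → X → Prop) :
    A → Quotient s → Quotient s → Prop :=
  fun x u v => ∃ u' v', (Quotient.mk s u') = u ∧ (Quotient.mk s v') = v ∧ R x u' v'

lemma lq_mk {s : Setoid X} {R : A → X → X → Prop} (L : Loc R Set.univ)
    (hs : ∀ u v, s u v ↔ R ident u v) (x : A) (u v : X) :
    lq s R x (Quotient.mk s u) (Quotient.mk s v) ↔ R x u v := by
  constructor
  · rintro ⟨u', v', hu, hv, h⟩
    have h1 := (hs _ _).1 (Quotient.exact hu)
    have h2 := (hs _ _).1 (Quotient.exact hv)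
    exact loc_inv L (loc_symm L h1) h2 h
  · intro h
    exact ⟨u, v, rfl, rfl, h⟩

lemma lq_rep {s : Setoid X} {R : A → X → X → Prop} (L : Loc R Set.univ)
    (hs : ∀ u v, s u v ↔ R ident u v)
    (hw : ∀ x y u w, R (x ⨾ y) u w → ∃ v, R x u v ∧ R y v w) : Rep (lq s R) := by
  refine ⟨?_, ?_, ?_, ?_, ?_⟩
  · intro x y u v
    induction u using Quotient.inductionOn
    induction v using Quotient.inductionOn
    rw [lq_mk L hs, lq_mk L hs, lq_mk L hs]
    exact L.sup _ _ _ trivial _ trivial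
  · intro x u v
    induction u using Quotient.inductionOn
    induction v using Quotient.inductionOn
    rw [lq_mk L hs, lq_mk L hs]
    exact L.compl _ _ trivial _ trivial
  · intro x u v
    induction u using Quotient.inductionOn
    induction v using Quotient.inductionOn
    rw [lq_mk L hs, lq_mk L hs]
    exact L.conv _ _ trivial _ trivial
  · intro x y u w
    induction u using Quotient.inductionOn
    induction w using Quotient.inductionOn
    rw [lq_mk L hs]
    constructor
    · intro h
      obtain ⟨v, h1, h2⟩ := hw _ _ _ _ h
      exact ⟨Quotient.mk s v, (lq_mk L hs _ _ _).2 h1, (lq_mk L hs _ _ _).2 h2⟩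
    · rintro ⟨v, h1, h2⟩
      induction v using Quotient.inductionOn
      rw [lq_mk L hs] at h1 h2
      exact L.comp _ _ _ trivial _ trivial _ trivial h1 h2
  · intro u v
    induction u using Quotient.inductionOn
    induction v using Quotient.inductionOn
    rw [lq_mk L hs, ← hs]
    exact ⟨fun h => Quotient.sound h, fun h => Quotient.exact h⟩

end Quot

lemma joint_rep {A B C : Type} [RelationAlgebra A] [RelationAlgebra B] [RelationAlgebra C]
    {f : C → A} {g : C → B} (hf : IsRAHom f) (hg : IsRAHom g) (hC : IsQRA C) {a : A} {b : B}
    (hab : ¬ ∃ t : C, a ≤ f t ∧ g t ≤ b) :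
    ∃ (X : Type) (M : A → X → X → Prop) (N : B → X → X → Prop),
      Rep M ∧ Rep N ∧ (∀ c, M (f c) = N (g c)) ∧ ∃ u v, M a u v ∧ ¬ N b u v := by
  obtain ⟨p, q, hp, hq, hpq⟩ := hC
  obtain ⟨M, N, LM, LN, hMN, W⟩ := joint hf hg hp hq hpq hab
  let s : Setoid (T A B) :=
    { r := fun u v => M ident u v
      iseqv := ⟨fun u => LM.ident u trivial, fun h => loc_symm LM h,
        fun {x y z} h1 h2 => by
          have := LM.comp _ _ x trivial y trivial z trivial h1 h2
          rwa [comp_ident] at this⟩ }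
  have hs : ∀ u v, s u v ↔ M ident u v := fun _ _ => Iff.rfl
  have hs' : ∀ u v, s u v ↔ N ident u v := by
    intro u v
    rw [hs, ← hf.2.2.2.2, ← hg.2.2.2.2]
    exact hMN _ _ _
  refine ⟨Quotient s, lq s M, lq s N, lq_rep LM hs ?_, lq_rep LN hs' ?_, ?_,
    Quotient.mk s T.b0, Quotient.mk s T.b1, ?_, ?_⟩
  · intro x y u w h
    exact ⟨_, (W.wa x y u w trivial).2.2 h⟩
  · intro x y u w h
    exact ⟨_, (W.wb x y u w trivial).2.2 h⟩
  · intro c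
    funext u v
    induction u using Quotient.inductionOn
    induction v using Quotient.inductionOn
    rw [lq_mk LM hs, lq_mk LN hs']
    exact propext (hMN _ _ _)
  · rw [lq_mk LM hs]; exact W.ha
  · rw [lq_mk LN hs']; exact W.hb

lemma inj_of_mono {A D : Type} [RelationAlgebra A] [RelationAlgebra D] {m : A → D}
    (h : ∀ x y, m x ≤ m y → x ≤ y) : Function.Injective m :=
  fun x y hxy => le_antisymm (h x y hxy.le) (h y x hxy.ge)

end QRAProof

/-- The class `QRA` of quasi-projective relation algebras has the
superamalgamation property: for all `A, B, C ∈ QRA` and monomorphisms `f : C → A`,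
`g : C → B` there are `D ∈ QRA` and monomorphisms `m : A → D`, `n : B → D` with
`m ∘ f = n ∘ g`, and whenever `m a ≤ n b` there is `t ∈ C` with `a ≤ f t` and `g t ≤ b`. -/
theorem qra_superamalgamation :
    ∀ (A : Type) [RelationAlgebra A], ∀ (B : Type) [RelationAlgebra B],
    ∀ (C : Type) [RelationAlgebra C],
      IsQRA A → IsQRA B → IsQRA C →
      ∀ (f : C → A) (g : C → B),
        IsRAHom f → Function.Injective f → IsRAHom g → Function.Injective g →
        ∃ (D : Type) (_ : RelationAlgebra D), IsQRA D ∧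
          ∃ (m : A → D) (n : B → D),
            IsRAHom m ∧ Function.Injective m ∧ IsRAHom n ∧ Function.Injective n ∧
            (∀ c : C, m (f c) = n (g c)) ∧
            (∀ (a : A) (b : B), m a ≤ n b → ∃ t : C, a ≤ f t ∧ g t ≤ b) := by
  intro A _ B _ C _ _ _ hC f g hf hfi hg hgi
  classical
  let I : Type := {ab : A × B // ¬ ∃ t : C, ab.1 ≤ f t ∧ g t ≤ ab.2}
  have key := fun i : I => QRAProof.joint_rep hf hg hC i.2
  choose X M N hM hN hMN hw using key
  letI : RelationAlgebra (∀ i, X i → X i → Prop) := QRAProof.relPi X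
  have hm : IsRAHom (fun (x : A) (i : I) => M i x) := QRAProof.hom_of_rep X M hM
  have hn : IsRAHom (fun (x : B) (i : I) => N i x) := QRAProof.hom_of_rep X N hN
  have sep : ∀ (a : A) (b : B), (fun (i : I) => M i a) ≤ (fun (i : I) => N i b) →
      ∃ t : C, a ≤ f t ∧ g t ≤ b := by
    intro a b h
    by_contra hc
    obtain ⟨u, v, h1, h2⟩ := hw ⟨(a, b), hc⟩
    exact h2 (h ⟨(a, b), hc⟩ u v h1)
  have f0 : ∀ t, f t = ⊥ → t = ⊥ := fun t ht => hfi (ht.trans (QRAProof.hom_bot hf).symm)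
  have g1 : ∀ t, g t = ⊥ → t = ⊥ := fun t ht => hgi (ht.trans (QRAProof.hom_bot hg).symm)
  have mb : ∀ a : A, (fun (i : I) => M i a) = ⊥ → a = ⊥ := by
    intro a ha
    obtain ⟨t, h1, h2⟩ := sep a ⊥ (by rw [ha]; exact bot_le)
    rw [g1 t (le_bot_iff.1 h2), QRAProof.hom_bot hf] at h1
    exact le_bot_iff.1 h1
  have nb : ∀ b : B, (fun (i : I) => N i b) = ⊤ → b = ⊤ := by
    intro b hb
    obtain ⟨t, h1, h2⟩ := sep ⊤ b (by rw [hb]; exact le_top)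
    have h3 : t = ⊤ := hfi ((top_le_iff.1 h1).trans (QRAProof.hom_top hf).symm)
    rw [h3, QRAProof.hom_top hg] at h2
    exact top_le_iff.1 h2
  refine ⟨∀ i, X i → X i → Prop, inferInstance, ?_, fun x i => M i x, fun x i => N i x,
    hm, ?_, hn, ?_, ?_, sep⟩
  · obtain ⟨p, q, hp, hq, hpq⟩ := hC
    refine ⟨fun i => M i (f p), fun i => M i (f q), QRAProof.hom_func hm (QRAProof.hom_func hf hp),
      QRAProof.hom_func hm (QRAProof.hom_func hf hq), ?_⟩
    have h1 := congrArg (fun z (i : I) => M i z) (congrArg f hpq)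
    rw [hf.2.2.1, hf.2.2.2.1, QRAProof.hom_top hf] at h1
    have h2 := hm.2.2.1 (RelationAlgebra.conv (f p)) (f q)
    have h3 := hm.2.2.2.1 (f p)
    have h4 := QRAProof.hom_top hm
    simp only at h1 h2 h3 h4
    rw [← h3, ← h2, h1, h4]
  · apply QRAProof.inj_of_mono
    intro x y hxy
    have h1 := mb (x ⊓ yᶜ) (by
      have h2 := QRAProof.hom_inf hm x yᶜ
      have h3 := hm.2.1 y
      simp only at h2 h3
      rw [h2, h3]
      exact disjoint_iff.1 (disjoint_compl_right_iff.2 hxy))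
    exact disjoint_compl_right_iff.1 (disjoint_iff.2 h1)
  · apply QRAProof.inj_of_mono
    intro x y hxy
    have h1 := nb (xᶜ ⊔ y) (by
      have h2 := hn.1 xᶜ y
      have h3 := hn.2.1 x
      simp only at h2 h3
      rw [h2, h3, ← top_le_iff, ← compl_sup_eq_top (x := fun i => N i x)]
      exact sup_le_sup_left hxy _)
    rw [← himp_eq_top_iff, himp_eq, sup_comm]
    exact h1
  · intro c
    funext i
    exact hMN i c
end

section
/- For every finite α ≥ 3, the class RCA↑_α of representable directed cylindric algebras of dimension α is a finitely axiomatizable variety (it is closed under homomorphic images, subalgebras and products, and is the class of models of a finite set of equations). -/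
/-- The similarity type of directed cylindric algebras of dimension `n`:
meet, complement, upward and downward directed cylindrifications, and diagonals. -/
structure DSig (n : ℕ) (A : Type) where
  inf : A → A → A
  compl : A → A
  cylu : Fin n → A → A
  cyld : Fin n → A → A
  diag : Fin n → Fin n → A

/-- A bundled algebra of the directed cylindric similarity type of dimension `n`. -/
structure DAlg (n : ℕ) where
  carrier : Type
  str : DSig n carrier

/-- `⟨U; R⟩` is a P-structure: any two elements have a "pair". -/
def IsPStruct (U : Type) (R : U → U → Prop) : Prop :=
  ∀ a b : U, ∃ c : U, ∀ d : U, R d c ↔ d = a ∨ d = b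

/-- `⟨U; R⟩` is a weak P-structure. -/
def IsWeakPStruct (U : Type) (R : U → U → Prop) : Prop :=
  ∀ a b : U, ∃ c : U, R a c ∧ R b c

/-- `⟨U; R⟩` is extensional: points with the same `R`-children coincide. -/
def IsExtensional (U : Type) (R : U → U → Prop) : Prop :=
  ∀ a b : U, (∀ z : U, R z a ↔ R z b) → a = b

/-- The full w-directed cylindric set algebra of dimension `n` with base `⟨U; R⟩`. -/
def fullDAlg (n : ℕ) (U : Type) (R : U → U → Prop) : DAlg n where
  carrier := Set (Fin n → U)
  str :=
    { inf := fun X Y => X ∩ Y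
      compl := fun X => Xᶜ
      cylu := fun i X =>
        {s | ∃ z ∈ X, R (z i) (s i) ∧ ∀ j : Fin n, j ≠ i → s j = z j}
      cyld := fun i X =>
        {s | ∃ z ∈ X, R (s i) (z i) ∧ ∀ j : Fin n, j ≠ i → s j = z j}
      diag := fun i j => {s | s i = s j} }

/-- A homomorphism of algebras of the directed cylindric similarity type. -/
def DHom {n : ℕ} (A B : DAlg n) (f : A.carrier → B.carrier) : Prop :=
  (∀ x y, f (A.str.inf x y) = B.str.inf (f x) (f y)) ∧
  (∀ x, f (A.str.compl x) = B.str.compl (f x)) ∧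
  (∀ (i : Fin n) x, f (A.str.cylu i x) = B.str.cylu i (f x)) ∧
  (∀ (i : Fin n) x, f (A.str.cyld i x) = B.str.cyld i (f x)) ∧
  (∀ i j : Fin n, f (A.str.diag i j) = B.str.diag i j)

/-- The product of a family of algebras of the directed cylindric similarity type. -/
def prodDAlg {n : ℕ} {ι : Type} (B : ι → DAlg n) : DAlg n where
  carrier := ∀ i : ι, (B i).carrier
  str :=
    { inf := fun x y i => (B i).str.inf (x i) (y i)
      compl := fun x i => (B i).str.compl (x i)
      cylu := fun k x i => (B i).str.cylu k (x i)
      cyld := fun k x i => (B i).str.cyld k (x i)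
      diag := fun k l i => (B i).str.diag k l }

/-- `Cs↑_n`: subalgebras of full w-directed cylindric set algebras whose base is an
extensional P-structure. -/
def CsUp (n : ℕ) : Set (DAlg n) :=
  {A | ∃ (U : Type) (R : U → U → Prop), IsPStruct U R ∧ IsExtensional U R ∧
        ∃ f : A.carrier → (fullDAlg n U R).carrier,
          Function.Injective f ∧ DHom A (fullDAlg n U R) f}

/-- `RCA↑_n = SP Cs↑_n`: the representable directed cylindric algebras of dimension `n`,
i.e. algebras embeddable into a product of members of `Cs↑_n`. -/
def RCAup (n : ℕ) : Set (DAlg n) :=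
  {A | ∃ (ι : Type) (B : ι → DAlg n), (∀ i, B i ∈ CsUp n) ∧
        ∃ f : A.carrier → (prodDAlg B).carrier, Function.Injective f ∧ DHom A (prodDAlg B) f}

/-- Terms of the directed cylindric similarity type of dimension `n`. -/
inductive DTerm (n : ℕ) : Type
  | var : ℕ → DTerm n
  | inf : DTerm n → DTerm n → DTerm n
  | compl : DTerm n → DTerm n
  | cylu : Fin n → DTerm n → DTerm n
  | cyld : Fin n → DTerm n → DTerm n
  | diag : Fin n → Fin n → DTerm n

/-- Evaluation of a term in an algebra of the directed similarity type. -/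
def DTerm.eval {n : ℕ} (A : DAlg n) (v : ℕ → A.carrier) : DTerm n → A.carrier
  | var i => v i
  | inf s t => A.str.inf (s.eval A v) (t.eval A v)
  | compl t => A.str.compl (t.eval A v)
  | cylu i t => A.str.cylu i (t.eval A v)
  | cyld i t => A.str.cyld i (t.eval A v)
  | diag i j => A.str.diag i j

/-- An algebra satisfies the equation `e = (s, t)` if `s` and `t` agree under every
assignment of the variables. -/
def SatisfiesEq {n : ℕ} (A : DAlg n) (e : DTerm n × DTerm n) : Prop :=
  ∀ v : ℕ → A.carrier, e.1.eval A v = e.2.eval A v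


structure QRA (K : Type) [BooleanAlgebra K] where
  comp : K → K → K
  conv : K → K
  one : K
  p : K
  q : K
  assoc : ∀ x y z, comp (comp x y) z = comp x (comp y z)
  one_comp : ∀ x, comp one x = x
  comp_one : ∀ x, comp x one = x
  conv_conv : ∀ x, conv (conv x) = x
  conv_comp : ∀ x y, conv (comp x y) = comp (conv y) (conv x)
  conv_inf : ∀ x y, conv (x ⊓ y) = conv x ⊓ conv y
  comp_sup : ∀ x y z, comp x (y ⊔ z) = comp x y ⊔ comp x z
  sup_comp : ∀ x y z, comp (y ⊔ z) x = comp y x ⊔ comp z x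
  comp_bot : ∀ x, comp x ⊥ = ⊥
  bot_comp : ∀ x, comp ⊥ x = ⊥
  mod1 : ∀ x y z, comp x y ⊓ z ≤ comp x (y ⊓ comp (conv x) z)
  mod2 : ∀ x y z, comp x y ⊓ z ≤ comp (x ⊓ comp z (conv y)) y
  pfun : comp (conv p) p ≤ one
  ptot : one ≤ comp p (conv p)
  qfun : comp (conv q) q ≤ one
  qtot : one ≤ comp q (conv q)
  pq : comp (conv p) q = ⊤

namespace QRA
variable {K : Type} [BooleanAlgebra K] (Q : QRA K)

theorem comp_mono {x x' y y' : K} (h : x ≤ x') (h' : y ≤ y') : Q.comp x y ≤ Q.comp x' y' := by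
  have h1 : Q.comp x y ≤ Q.comp x' y := by
    rw [← sup_eq_right.2 h, Q.sup_comp]; exact le_sup_left
  have h2 : Q.comp x' y ≤ Q.comp x' y' := by
    rw [← sup_eq_right.2 h', Q.comp_sup]; exact le_sup_left
  exact h1.trans h2

theorem conv_mono {x y : K} (h : x ≤ y) : Q.conv x ≤ Q.conv y := by
  rw [← inf_eq_left.2 h, Q.conv_inf]; exact inf_le_right

theorem conv_one : Q.conv Q.one = Q.one := by
  have h := Q.conv_comp (Q.conv Q.one) Q.one
  rw [Q.comp_one, Q.conv_conv, Q.comp_one] at h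
  exact h.symm

def IsFn (f : K) : Prop := Q.comp (Q.conv f) f ≤ Q.one ∧ Q.one ≤ Q.comp f (Q.conv f)

def br (f g r : K) : K := Q.one ⊓ Q.comp (Q.comp f r) (Q.conv g)

theorem isFn_one : Q.IsFn Q.one := by
  constructor <;> rw [conv_one, Q.comp_one]

theorem isFn_comp {f g : K} (hf : Q.IsFn f) (hg : Q.IsFn g) : Q.IsFn (Q.comp f g) := by
  constructor
  · rw [Q.conv_comp, Q.assoc, ← Q.assoc _ f g]
    calc _ ≤ Q.comp (Q.conv g) (Q.comp Q.one g) :=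
          Q.comp_mono le_rfl (Q.comp_mono hf.1 le_rfl)
      _ ≤ _ := by rw [Q.one_comp]; exact hg.1
  · rw [Q.conv_comp, Q.assoc, ← Q.assoc g]
    calc Q.one ≤ Q.comp f (Q.comp Q.one (Q.conv f)) := by rw [Q.one_comp]; exact hf.2
      _ ≤ _ := Q.comp_mono le_rfl (Q.comp_mono hg.2 le_rfl)

theorem fn_inf {f : K} (hf : Q.IsFn f) (r s : K) :
    Q.comp f (r ⊓ s) = Q.comp f r ⊓ Q.comp f s := by
  apply le_antisymm
  · exact le_inf (Q.comp_mono le_rfl inf_le_left) (Q.comp_mono le_rfl inf_le_right)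
  · refine (Q.mod1 _ _ _).trans (Q.comp_mono le_rfl (inf_le_inf_left _ ?_))
    rw [← Q.assoc]
    exact (Q.comp_mono hf.1 le_rfl).trans (by rw [Q.one_comp])

theorem inf_fn {f : K} (hf : Q.IsFn f) (r s : K) :
    Q.comp (r ⊓ s) (Q.conv f) = Q.comp r (Q.conv f) ⊓ Q.comp s (Q.conv f) := by
  have h := congrArg Q.conv (Q.fn_inf hf (Q.conv r) (Q.conv s))
  simpa only [Q.conv_comp, Q.conv_inf, Q.conv_conv] using h

theorem br_inf {f g : K} (hf : Q.IsFn f) (hg : Q.IsFn g) (r s : K) :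
    Q.br f g (r ⊓ s) = Q.br f g r ⊓ Q.br f g s := by
  unfold br; rw [Q.fn_inf hf, Q.inf_fn hg, inf_inf_distrib_left]

theorem br_mono {f g r s : K} (h : r ≤ s) : Q.br f g r ≤ Q.br f g s :=
  inf_le_inf_left _ (Q.comp_mono (Q.comp_mono le_rfl h) le_rfl)

theorem br_sup (f g r s : K) : Q.br f g (r ⊔ s) = Q.br f g r ⊔ Q.br f g s := by
  unfold br; rw [Q.comp_sup, Q.sup_comp, inf_sup_left]

theorem br_bot (f g : K) : Q.br f g ⊥ = ⊥ := by
  unfold br; rw [Q.comp_bot, Q.bot_comp, inf_bot_eq]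

theorem br_le (f g r : K) : Q.br f g r ≤ Q.one := inf_le_left

theorem br_top {f g : K} (hf : Q.IsFn f) (hg : Q.IsFn g) : Q.br f g ⊤ = Q.one := by
  unfold br
  have h1 : Q.comp f ⊤ = ⊤ := by
    rw [eq_top_iff]
    calc ⊤ = Q.comp Q.one ⊤ := (Q.one_comp _).symm
      _ ≤ Q.comp (Q.comp f (Q.conv f)) ⊤ := Q.comp_mono hf.2 le_rfl
      _ ≤ _ := by rw [Q.assoc]; exact Q.comp_mono le_rfl le_top
  have h2 : Q.comp ⊤ (Q.conv g) = ⊤ := by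
    rw [eq_top_iff]
    calc ⊤ = Q.comp ⊤ Q.one := (Q.comp_one _).symm
      _ ≤ Q.comp ⊤ (Q.comp g (Q.conv g)) := Q.comp_mono le_rfl hg.2
      _ ≤ _ := by rw [← Q.assoc]; exact Q.comp_mono le_top le_rfl
  rw [h1, h2, inf_top_eq]

theorem sub_conv_le {a : K} (h : a ≤ Q.one) : a ≤ Q.conv a := by
  have h1 := Q.mod1 a Q.one a
  rw [Q.comp_one, inf_idem] at h1
  refine h1.trans ((Q.comp_mono h inf_le_right).trans ?_)
  rw [Q.one_comp]
  exact (Q.comp_mono le_rfl h).trans (by rw [Q.comp_one])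

theorem sub_conv {a : K} (h : a ≤ Q.one) : Q.conv a = a := by
  apply le_antisymm _ (Q.sub_conv_le h)
  have := Q.conv_mono (Q.sub_conv_le h)
  rwa [Q.conv_conv] at this

theorem sub_inf {a b : K} (ha : a ≤ Q.one) : a ⊓ b ≤ Q.comp a b := by
  have h1 := Q.mod1 a Q.one b
  rw [Q.comp_one] at h1
  refine h1.trans (Q.comp_mono le_rfl (inf_le_right.trans ?_))
  rw [Q.sub_conv ha]
  exact (Q.comp_mono ha le_rfl).trans (by rw [Q.one_comp])

theorem br_comp {f g h : K} (hh : Q.IsFn h) (r s : K) :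
    Q.br f h r ⊓ Q.br h g s ≤ Q.br f g (Q.comp r s) := by
  refine le_inf (inf_le_left.trans inf_le_left) ?_
  refine (Q.sub_inf (Q.br_le _ _ _)).trans ?_
  refine (Q.comp_mono inf_le_right inf_le_right).trans ?_
  simp only [Q.assoc]
  refine Q.comp_mono le_rfl (Q.comp_mono le_rfl ?_)
  rw [← Q.assoc]
  exact (Q.comp_mono hh.1 le_rfl).trans (by rw [Q.one_comp])

theorem br_conv (f g r : K) : Q.br f g (Q.conv r) = Q.br g f r := by
  rw [← Q.sub_conv (Q.br_le g f r)]
  unfold br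
  rw [Q.conv_inf, Q.conv_one, Q.conv_comp, Q.conv_comp, Q.conv_conv, Q.assoc]

theorem br_one {f : K} (hf : Q.IsFn f) : Q.br f f Q.one = Q.one := by
  unfold br; rw [Q.comp_one]; exact inf_eq_left.2 hf.2

theorem br_br {h f g : K} (hh : Q.IsFn h) (r : K) :
    Q.br (Q.comp h f) (Q.comp h g) r = Q.br h h (Q.br f g r) := by
  conv_rhs => unfold br
  rw [Q.fn_inf hh, Q.inf_fn hh, Q.comp_one, ← inf_assoc, inf_eq_left.2 hh.2]
  unfold br
  simp only [Q.conv_comp, Q.assoc]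

theorem isFn_p : Q.IsFn Q.p := ⟨Q.pfun, Q.ptot⟩
theorem isFn_q : Q.IsFn Q.q := ⟨Q.qfun, Q.qtot⟩

theorem br_ext {f g b r s : K} (hb : b ≠ ⊥)
    (h : b ≤ Q.br f g (Q.comp r s)) :
    Q.br Q.p Q.p b ⊓ (Q.br (Q.comp Q.p f) Q.q r ⊓ Q.br Q.q (Q.comp Q.p g) s) ≠ ⊥ := by
  intro h0
  apply hb
  have hb1 : b ≤ Q.one := h.trans (Q.br_le _ _ _)
  set X := Q.comp f r
  set Y := Q.comp g (Q.conv s)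
  set Z := Q.comp b (X ⊓ Y)
  have e1 : Q.br (Q.comp Q.p f) Q.q r ⊓ Q.br Q.q (Q.comp Q.p g) s = Q.br Q.p Q.q (X ⊓ Y) := by
    rw [Q.br_inf Q.isFn_p Q.isFn_q, ← Q.br_conv _ _ s]
    unfold br
    simp only [X, Y, Q.assoc]
  have hZ : Z ≤ X ⊓ Y := (Q.comp_mono hb1 le_rfl).trans (by rw [Q.one_comp])
  have e2 : Q.br Q.p Q.q Z ≤ Q.br Q.p Q.p b := by
    refine le_inf inf_le_left ?_
    unfold br
    have := Q.mod1 (Q.comp Q.p b) (Q.comp (X ⊓ Y) (Q.conv Q.q)) Q.one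
    rw [Q.comp_one] at this
    rw [inf_comm]
    refine le_trans (le_of_eq ?_) (this.trans (Q.comp_mono le_rfl (inf_le_right.trans ?_)))
    · simp only [Z, Q.assoc]
    · rw [Q.conv_comp, Q.sub_conv hb1]
      exact (Q.comp_mono hb1 le_rfl).trans (by rw [Q.one_comp])
  have e3 : Q.br Q.p Q.q Z = ⊥ := by
    rw [eq_bot_iff, ← h0, e1]
    exact le_inf e2 (Q.br_mono hZ)
  have e4 : Q.comp Q.p Z ⊓ Q.q = ⊥ := by
    have := Q.mod2 Q.one Q.q (Q.comp Q.p Z)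
    rw [Q.one_comp] at this
    change _ ≤ Q.comp (Q.br Q.p Q.q Z) _ at this
    rw [e3, Q.bot_comp] at this
    rw [eq_bot_iff, inf_comm]; exact this
  have e5 : Z = ⊥ := by
    have := Q.mod1 (Q.conv Q.p) Q.q Z
    rw [Q.pq, top_inf_eq, Q.conv_conv, inf_comm, e4, Q.comp_bot] at this
    exact eq_bot_iff.2 this
  have e6 : b ≤ Q.comp (X ⊓ Y) (Q.conv Y) := by
    have := Q.mod2 X (Q.conv Y) Q.one
    rw [Q.conv_conv, Q.one_comp] at this
    refine le_trans (le_inf (h.trans (inf_le_right.trans (le_of_eq ?_))) hb1) this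
    simp only [X, Y, Q.conv_comp, Q.conv_conv, Q.assoc]
  have e7 : b ≤ Q.comp b b := by
    have := Q.sub_inf hb1 (b := b)
    rwa [inf_idem] at this
  have e8 := e7.trans (Q.comp_mono le_rfl e6)
  rw [← Q.assoc] at e8
  change b ≤ Q.comp Z _ at e8
  rw [e5, Q.bot_comp] at e8
  exact eq_bot_iff.2 e8

end QRA

inductive WTerm (K : Type) : Type
  | c : WTerm K
  | wit : K → K → WTerm K → WTerm K → WTerm K

def WTerm.size {K : Type} : WTerm K → ℕ
  | .c => 0
  | .wit _ _ x y => x.size + y.size + 1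

namespace QRA
variable {K : Type} [BooleanAlgebra K] (Q : QRA K)

theorem exists_assign (b0 : K) (hb0 : b0 ≠ ⊥) (hb1 : b0 ≤ Q.one) (S : Finset (WTerm K)) :
    ∃ (φ : WTerm K → K) (b : K), (∀ w, Q.IsFn (φ w)) ∧ b ≠ ⊥ ∧ b ≤ Q.one ∧
      b ≤ Q.br (φ .c) (φ .c) b0 ∧
      ∀ r s x y, WTerm.wit r s x y ∈ S →
        b ⊓ Q.br (φ x) (φ y) (Q.comp r s) ≤
          Q.br (φ x) (φ (.wit r s x y)) r ⊓ Q.br (φ (.wit r s x y)) (φ y) s := by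
  classical
  refine Finset.induction_on_max_value WTerm.size S ?_ ?_
  · refine ⟨fun _ => Q.one, b0, fun _ => Q.isFn_one, hb0, hb1, ?_, by simp⟩
    unfold br
    rw [Q.conv_one, Q.comp_one, Q.one_comp]; exact le_inf hb1 le_rfl
  · intro a S ha hmax ih
    obtain ⟨φ, b, hφ, hb, hbo, hbc, hS⟩ := ih
    cases a with
    | c =>
      refine ⟨φ, b, hφ, hb, hbo, hbc, ?_⟩
      intro r s x y h
      apply hS
      simpa using h
    | wit r t x y =>
      let a := WTerm.wit r t x y
      have hpp := Q.isFn_p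
      -- new assignment
      let ψ : WTerm K → K := fun z => if z = a then Q.q else Q.comp Q.p (φ z)
      have hψ : ∀ w, Q.IsFn (ψ w) := by
        intro w; by_cases h : w = a
        · simp only [ψ, h, if_true]; exact Q.isFn_q
        · simp only [ψ, h, if_false]; exact Q.isFn_comp hpp (hφ w)
      have ha' : ψ a = Q.q := by simp [ψ]
      have hn : ∀ z, z.size < a.size ∨ z ∈ S → ψ z = Q.comp Q.p (φ z) := by
        intro z hz
        have : z ≠ a := by
          rintro rfl
          rcases hz with hz | hz
          · exact lt_irrefl _ hz
          · exact ha hz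
        simp [ψ, this]
      have hc : ψ .c = Q.comp Q.p (φ .c) := hn _ (Or.inl (by simp [a, WTerm.size]))
      have hx : ψ x = Q.comp Q.p (φ x) := hn _ (Or.inl (by simp only [a, WTerm.size]; omega))
      have hy : ψ y = Q.comp Q.p (φ y) := hn _ (Or.inl (by simp only [a, WTerm.size]; omega))
      -- general step
      have key : ∀ b' : K, b' ≠ ⊥ → b' ≤ Q.br Q.p Q.p b →
          b' ⊓ Q.br (ψ x) (ψ y) (Q.comp r t) ≤ Q.br (ψ x) (ψ a) r ⊓ Q.br (ψ a) (ψ y) t →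
          ∃ (φ : WTerm K → K) (b : K), (∀ w, Q.IsFn (φ w)) ∧ b ≠ ⊥ ∧ b ≤ Q.one ∧
            b ≤ Q.br (φ .c) (φ .c) b0 ∧
            ∀ r' s x' y', WTerm.wit r' s x' y' ∈ insert (WTerm.wit r t x y) S →
              b ⊓ Q.br (φ x') (φ y') (Q.comp r' s) ≤
                Q.br (φ x') (φ (.wit r' s x' y')) r' ⊓ Q.br (φ (.wit r' s x' y')) (φ y') s := by
        intro b' h1 h2 h3
        refine ⟨ψ, b', hψ, h1, h2.trans (Q.br_le _ _ _), ?_, ?_⟩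
        · rw [hc, Q.br_br hpp]; exact h2.trans (Q.br_mono hbc)
        · intro r' s x' y' hm
          rcases Finset.mem_insert.1 hm with hm | hm
          · cases hm; exact h3
          · have hs := hmax _ hm
            have hx' : ψ x' = Q.comp Q.p (φ x') :=
              hn _ (Or.inl (by simp only [a, WTerm.size] at hs ⊢; omega))
            have hy' : ψ y' = Q.comp Q.p (φ y') :=
              hn _ (Or.inl (by simp only [a, WTerm.size] at hs ⊢; omega))
            rw [hx', hy', hn _ (Or.inr hm)]
            simp only [Q.br_br hpp]
            rw [← Q.br_inf hpp hpp]
            refine (inf_le_inf_right _ h2).trans ?_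
            rw [← Q.br_inf hpp hpp]
            exact Q.br_mono (hS _ _ _ _ hm)
      by_cases h : b ⊓ Q.br (φ x) (φ y) (Q.comp r t) = ⊥
      · apply key (Q.br Q.p Q.p b) _ le_rfl
        · rw [hx, hy, Q.br_br hpp, ← Q.br_inf hpp hpp, h, Q.br_bot]; exact bot_le
        · have hh : b ≤ Q.br Q.one Q.one (Q.comp Q.one Q.one) := by
            rw [Q.comp_one, Q.br_one Q.isFn_one]; exact hbo
          have := Q.br_ext hb hh
          intro h'
          rw [h', bot_inf_eq] at this
          exact this rfl
      · have := Q.br_ext h inf_le_right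
        refine key _ this (inf_le_left.trans (Q.br_mono inf_le_left)) ?_
        rw [hx, hy, ha']
        exact inf_le_left.trans inf_le_right

theorem exists_char (b : K) (hb : b ≠ ⊥) : ∃ χ : K → Prop, χ b ∧ (∀ x y, χ (x ⊓ y) ↔ χ x ∧ χ y) ∧
    ∀ x, χ xᶜ ↔ ¬ χ x := by
  have hd : Disjoint ((Order.PFilter.principal b : Order.PFilter K) : Set K)
      ((Order.Ideal.principal (⊥ : K) : Order.Ideal K) : Set K) := by
    rw [Set.disjoint_left]
    intro x hx hx'
    have h1 : b ≤ x := by simpa using hx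
    have h2 : x ≤ ⊥ := Order.Ideal.mem_principal.1 hx'
    exact hb (le_bot_iff.1 (h1.trans h2))
  obtain ⟨J, hJ, -, hJd⟩ := DistribLattice.prime_ideal_of_disjoint_filter_ideal hd
  have hinf : ∀ x y, x ⊓ y ∈ J → x ∈ J ∨ y ∈ J := fun x y h => hJ.mem_or_mem h
  have htop : (⊤ : K) ∉ J := by
    intro h
    have hbJ : b ∈ J := J.lower le_top h
    exact Set.disjoint_left.1 hJd (by simp) hbJ
  refine ⟨fun x => x ∉ J, ?_, ?_, ?_⟩
  · intro h; exact Set.disjoint_left.1 hJd (by simp) h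
  · intro x y
    constructor
    · intro h
      exact ⟨fun h' => h (J.lower inf_le_left h'), fun h' => h (J.lower inf_le_right h')⟩
    · rintro ⟨h1, h2⟩ h
      rcases hinf _ _ h with h | h
      · exact h1 h
      · exact h2 h
  · intro x
    rw [not_not]
    constructor
    · intro h
      rcases hinf x xᶜ (by rw [inf_compl_eq_bot]; exact J.bot_mem) with h' | h'
      · exact h'
      · exact absurd h' h
    · intro h h'
      apply htop
      rw [← sup_compl_eq_top (x := x)]
      exact Order.Ideal.sup_mem h h'

theorem exists_H (b0 : K) (hb0 : b0 ≠ ⊥) (hb1 : b0 ≤ Q.one) :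
    ∃ H : K → WTerm K → WTerm K → Prop, H b0 .c .c ∧
      (∀ r s x y, H (r ⊓ s) x y ↔ H r x y ∧ H s x y) ∧
      (∀ r x y, H rᶜ x y ↔ ¬ H r x y) ∧
      (∀ r x y, H (Q.conv r) x y ↔ H r y x) ∧
      (∀ x, H Q.one x x) ∧
      (∀ r s x y, H (Q.comp r s) x y ↔ ∃ z, H r x z ∧ H s z y) := by
  classical
  choose φ b hφ hb hbo hbc hS using Q.exists_assign b0 hb0 hb1
  choose χ hχb hχi hχc using fun S => exists_char (b S) (hb S)
  have mono : ∀ S x y, x ≤ y → χ S x → χ S y := by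
    intro S x y h hx
    rw [← inf_eq_left.2 h, hχi] at hx
    exact hx.2
  let 𝓤 : Ultrafilter (Finset (WTerm K)) := Ultrafilter.of Filter.atTop
  have h𝓤 : (𝓤 : Filter (Finset (WTerm K))) ≤ Filter.atTop := Ultrafilter.of_le _
  have hone : ∀ S, χ S Q.one := fun S => mono S _ _ (hbo S) (hχb S)
  refine ⟨fun r x y => ∀ᶠ S in (𝓤 : Filter (Finset (WTerm K))), χ S (Q.br (φ S x) (φ S y) r), ?_, ?_, ?_, ?_, ?_, ?_⟩
  · exact Filter.Eventually.of_forall fun S => mono S _ _ (hbc S) (hχb S)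
  · intro r s x y
    rw [← Filter.eventually_and]
    refine Filter.eventually_congr (Filter.Eventually.of_forall fun S => ?_)
    rw [Q.br_inf (hφ S x) (hφ S y), hχi]
  · intro r x y
    rw [← Ultrafilter.eventually_not]
    refine Filter.eventually_congr (Filter.Eventually.of_forall fun S => ?_)
    have hi := Q.br_inf (hφ S x) (hφ S y) r rᶜ
    have hs := Q.br_sup (φ S x) (φ S y) r rᶜ
    rw [inf_compl_eq_bot, Q.br_bot] at hi
    rw [sup_compl_eq_top, Q.br_top (hφ S x) (hφ S y)] at hs
    have hbot : ¬ χ S ⊥ := by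
      have := hχi S Q.one Q.oneᶜ
      rw [inf_compl_eq_bot, hχc] at this
      tauto
    constructor
    · intro h1 h2
      apply hbot; rw [hi, hχi]; exact ⟨h2, h1⟩
    · intro h1
      rw [← hχc] at h1
      have := (hχi S _ _).2 ⟨h1, hone S⟩
      refine mono S _ _ ?_ this
      rw [hs, inf_sup_left, compl_inf_eq_bot, bot_sup_eq]
      exact inf_le_right
  · intro r x y
    simp only [Q.br_conv]
  · intro x
    refine Filter.Eventually.of_forall fun S => ?_
    rw [Q.br_one (hφ S x)]; exact hone S
  · intro r s x y
    constructor
    · intro h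
      refine ⟨.wit r s x y, ?_⟩
      rw [← Filter.eventually_and]
      have h2 : ∀ᶠ S in (𝓤 : Filter (Finset (WTerm K))), WTerm.wit r s x y ∈ S := by
        apply h𝓤
        filter_upwards [Filter.eventually_ge_atTop ({WTerm.wit r s x y} : Finset (WTerm K))] with S hS
        exact hS (by simp)
      filter_upwards [h, h2] with S h h2
      rw [← hχi]
      exact mono S _ _ (hS S r s x y h2) ((hχi S _ _).2 ⟨hχb S, h⟩)
    · rintro ⟨z, h1, h2⟩
      filter_upwards [h1, h2] with S h1 h2
      exact mono S _ _ (Q.br_comp (hφ S z) r s) ((hχi S _ _).2 ⟨h1, h2⟩)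

theorem exists_rep (b0 : K) (hb0 : b0 ≠ ⊥) (hb1 : b0 ≤ Q.one) :
    ∃ (U : Type) (H : K → U → U → Prop), (∃ u, H b0 u u) ∧
      (∀ r s x y, H (r ⊓ s) x y ↔ H r x y ∧ H s x y) ∧
      (∀ r x y, H rᶜ x y ↔ ¬ H r x y) ∧
      (∀ r x y, H (Q.conv r) x y ↔ H r y x) ∧
      (∀ x y, H Q.one x y ↔ x = y) ∧
      (∀ r s x y, H (Q.comp r s) x y ↔ ∃ z, H r x z ∧ H s z y) := by
  obtain ⟨H, h0, hi, hc, hv, ho, hm⟩ := Q.exists_H b0 hb0 hb1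
  let st : Setoid (WTerm K) :=
    { r := fun x y => H Q.one x y
      iseqv := ⟨ho, fun {x y} h => by rw [← hv, Q.conv_one]; exact h,
        fun {x y z} h h' => by rw [← Q.comp_one Q.one, hm]; exact ⟨y, h, h'⟩⟩ }
  have hl : ∀ r x y x' y', st x x' → st y y' → H r x y → H r x' y' := by
    intro r x y x' y' hx hy h
    have hx' : H Q.one x' x := st.symm hx
    rw [← Q.one_comp r, hm]
    refine ⟨x, hx', ?_⟩
    rw [← Q.comp_one r, hm]
    exact ⟨y, h, hy⟩
  let H' : K → Quotient st → Quotient st → Prop := fun r => Quotient.lift₂ (H r) (by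
    intro x y x' y' hx hy
    exact propext ⟨hl r _ _ _ _ hx hy, hl r _ _ _ _ (st.symm hx) (st.symm hy)⟩)
  refine ⟨Quotient st, H', ⟨Quotient.mk st .c, h0⟩, ?_, ?_, ?_, ?_, ?_⟩
  · intro r s x y
    induction x using Quotient.ind; induction y using Quotient.ind
    exact hi _ _ _ _
  · intro r x y
    induction x using Quotient.ind; induction y using Quotient.ind
    exact hc _ _ _
  · intro r x y
    induction x using Quotient.ind; induction y using Quotient.ind
    exact hv _ _ _
  · intro x y
    induction x using Quotient.ind; induction y using Quotient.ind
    exact (Quotient.eq (r := st)).symm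
  · intro r s x y
    induction x using Quotient.ind; induction y using Quotient.ind
    refine (hm _ _ _ _).trans ⟨fun ⟨z, h⟩ => ⟨Quotient.mk st z, h⟩, ?_⟩
    rintro ⟨z, h⟩
    induction z using Quotient.ind
    exact ⟨_, h⟩

end QRA

namespace DSig
variable {m : ℕ} {A : Type} (S : DSig (m+3) A)

def sup (x y : A) : A := S.compl (S.inf (S.compl x) (S.compl y))
def top : A := S.diag 0 0
def bot : A := S.compl S.top
def C (i : Fin (m+3)) (x : A) : A := S.cyld i (S.cylu i x)
def CL (l : List (Fin (m+3))) (x : A) : A := l.foldr S.C x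
def infL (l : List A) : A := l.foldr S.inf S.top
def bin (x : A) : A := S.CL ((List.finRange (m+3)).filter (fun j => j ≠ 0 ∧ j ≠ 1)) x
def sb (i j : Fin (m+3)) (x : A) : A := S.C i (S.inf (S.diag i j) x)
def comp (x y : A) : A := S.C 2 (S.inf (S.sb 1 2 x) (S.sb 0 2 y))
def conv (x : A) : A := S.sb 2 1 (S.sb 1 0 (S.sb 0 2 x))
def one : A := S.diag 0 1
def uniq (T : A → A) : A := S.inf (S.C 1 (T (S.diag 0 1)))
  (S.compl (S.C 1 (S.C 2 (S.inf (T (S.diag 0 1))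
    (S.inf (T (S.diag 0 2)) (S.compl (S.diag 1 2)))))))
def sing : A := S.uniq (S.cylu 0)
def nn : A := S.sup (S.compl S.sing) (S.compl (S.C 0 (S.C 1 (S.compl (S.diag 0 1)))))
def path0 (x : A) : A := S.cylu 0 (S.inf S.sing (S.cylu 0 x))
def path1 (x : A) : A := S.cylu 0 (S.inf S.nn (S.path0 x))
def tot (T : A → A) (x : A) : A := S.sup (S.inf (S.uniq T) (T x)) (S.inf (S.compl (S.uniq T)) x)
def p : A := S.tot S.path0 (S.diag 0 1)
def q : A := S.tot S.path1 (S.diag 0 1)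
def r : A := S.cyld 0 (S.diag 0 1)
def qs : ℕ → A
  | 0 => S.p
  | k+1 => S.comp S.q (qs k)
def atc (i : Fin (m+3)) (x : A) : A := if i = 1 then x else S.sb 1 i x
def hat (x : A) : A :=
  S.CL ((List.finRange (m+3)).filter (fun j => j ≠ 0))
    (S.inf (S.tot S.path0 x)
      (S.infL (((List.finRange (m+3)).filter (fun j => j ≠ 0)).map
        (fun i => S.atc i (S.qs i)))))
def agr (l : List (Fin (m+3))) : A := S.infL (l.map (fun j : Fin (m+3) => S.comp (S.qs j) (S.conv (S.qs j))))
def agx (i : Fin (m+3)) : A := S.agr ((List.finRange (m+3)).filter (fun j => j ≠ i))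

def axBA (x y z : A) : List (A × A) :=
  [ (S.sup x y, S.sup y x),
    (S.sup (S.sup x y) z, S.sup x (S.sup y z)),
    (S.inf x y, S.inf y x),
    (S.inf (S.inf x y) z, S.inf x (S.inf y z)),
    (S.sup x (S.inf x y), x),
    (S.inf x (S.sup x y), x),
    (S.inf (S.sup x y) (S.sup x z), S.sup x (S.inf y z)),
    (S.inf x (S.compl x), S.bot),
    (S.sup x (S.compl x), S.top),
    (S.sup x S.top, S.top),
    (S.sup S.bot x, x) ]

def axBin (x a b : A) : List (A × A) :=
  [ (S.bin (S.inf a b), S.inf a b),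
    (S.bin (S.compl a), S.compl a),
    (S.bin (S.bin x), S.bin x),
    (S.bin (S.comp a b), S.comp a b),
    (S.bin (S.conv a), S.conv a),
    (S.bin S.one, S.one),
    (S.bin S.p, S.p),
    (S.bin S.q, S.q),
    (S.bin S.r, S.r),
    (S.bin S.top, S.top),
    (S.bin (S.hat x), S.hat x) ]

def leq (x y : A) : A × A := (S.sup x y, y)

def axRA (a b c : A) : List (A × A) :=
  [ (S.comp (S.comp a b) c, S.comp a (S.comp b c)),
    (S.comp S.one a, a),
    (S.comp a S.one, a),
    (S.conv (S.conv a), a),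
    (S.conv (S.comp a b), S.comp (S.conv b) (S.conv a)),
    (S.conv (S.inf a b), S.inf (S.conv a) (S.conv b)),
    (S.comp a (S.sup b c), S.sup (S.comp a b) (S.comp a c)),
    (S.comp (S.sup b c) a, S.sup (S.comp b a) (S.comp c a)),
    (S.comp a S.bot, S.bot),
    (S.comp S.bot a, S.bot),
    S.leq (S.inf (S.comp a b) c) (S.comp a (S.inf b (S.comp (S.conv a) c))),
    S.leq (S.inf (S.comp a b) c) (S.comp (S.inf a (S.comp c (S.conv b))) b),
    S.leq (S.comp (S.conv S.p) S.p) S.one,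
    S.leq S.one (S.comp S.p (S.conv S.p)),
    S.leq (S.comp (S.conv S.q) S.q) S.one,
    S.leq S.one (S.comp S.q (S.conv S.q)),
    (S.comp (S.conv S.p) S.q, S.top) ]

def extT : A := S.sup (S.comp (S.conv S.r) (S.compl S.r)) (S.comp (S.compl (S.conv S.r)) S.r)
def pairT : A := S.inf (S.comp S.p S.r) (S.inf (S.comp S.q S.r)
  (S.compl (S.comp (S.inf (S.comp S.p (S.compl S.one)) (S.comp S.q (S.compl S.one))) S.r)))

def axHat (x y : A) : List (A × A) :=
  [ (S.hat (S.inf x y), S.inf (S.hat x) (S.hat y)),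
    (S.hat (S.compl x), S.compl (S.hat x)),
    S.leq (S.comp (S.agr (List.finRange (m+3))) (S.hat x)) (S.hat x),
    (S.hat x, S.comp (S.inf S.one (S.hat x)) S.top),
    S.leq x (S.CL (List.finRange (m+3)) (S.hat x)),
    (S.CL (List.finRange (m+3)) S.bot, S.bot),
    (S.sup S.extT S.one, S.top),
    (S.comp S.pairT S.top, S.top) ]

def axD (i j : Fin (m+3)) : A × A :=
  (S.hat (S.diag i j), S.comp (S.inf S.one (S.comp (S.qs i) (S.conv (S.qs j)))) S.top)
def axU (x : A) (i : Fin (m+3)) : A × A :=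
  (S.hat (S.cylu i x), S.comp (S.inf (S.agx i)
    (S.comp (S.comp (S.qs i) (S.conv S.r)) (S.conv (S.qs i)))) (S.hat x))
def axL (x : A) (i : Fin (m+3)) : A × A :=
  (S.hat (S.cyld i x), S.comp (S.inf (S.agx i)
    (S.comp (S.comp (S.qs i) S.r) (S.conv (S.qs i)))) (S.hat x))

def axs (x y z : A) : List (A × A) :=
  S.axBA x y z ++ S.axBin x (S.bin x) (S.bin y) ++ S.axRA (S.bin x) (S.bin y) (S.bin z) ++
    S.axHat x y ++
    (List.finRange (m+3)).flatMap (fun i => (List.finRange (m+3)).map (fun j => S.axD i j)) ++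
    (List.finRange (m+3)).map (fun i => S.axU x i) ++
    (List.finRange (m+3)).map (fun i => S.axL x i)

def Models : Prop := ∀ x y z, ∀ e ∈ S.axs x y z, e.1 = e.2

section nat
variable {B : Type} {S} {S' : DSig (m+3) B} {f : A → B} (h : DHom ⟨_, S⟩ ⟨_, S'⟩ f)

theorem n_inf (h : DHom ⟨_, S⟩ ⟨_, S'⟩ f) (x y : A) : f (S.inf x y) = S'.inf (f x) (f y) := h.1 x y
theorem n_compl (h : DHom ⟨_, S⟩ ⟨_, S'⟩ f) (x : A) : f (S.compl x) = S'.compl (f x) := h.2.1 x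
theorem n_cylu (h : DHom ⟨_, S⟩ ⟨_, S'⟩ f) (i) (x : A) : f (S.cylu i x) = S'.cylu i (f x) := h.2.2.1 i x
theorem n_cyld (h : DHom ⟨_, S⟩ ⟨_, S'⟩ f) (i) (x : A) : f (S.cyld i x) = S'.cyld i (f x) := h.2.2.2.1 i x
theorem n_diag (h : DHom ⟨_, S⟩ ⟨_, S'⟩ f) (i j) : f (S.diag i j) = S'.diag i j := h.2.2.2.2 i j
theorem n_sup (h : DHom ⟨_, S⟩ ⟨_, S'⟩ f) (x y : A) : f (S.sup x y) = S'.sup (f x) (f y) := by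
  simp only [sup, n_inf h, n_compl h]
theorem n_top (h : DHom ⟨_, S⟩ ⟨_, S'⟩ f) : f S.top = S'.top := by
  simp only [top, n_diag h]
theorem n_bot (h : DHom ⟨_, S⟩ ⟨_, S'⟩ f) : f S.bot = S'.bot := by
  simp only [bot, n_top h, n_compl h]
theorem n_C (h : DHom ⟨_, S⟩ ⟨_, S'⟩ f) (i) (x : A) : f (S.C i x) = S'.C i (f x) := by
  simp only [C, n_cylu h, n_cyld h]
theorem n_CL (h : DHom ⟨_, S⟩ ⟨_, S'⟩ f) (l) (x : A) : f (S.CL l x) = S'.CL l (f x) := by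
  induction l with
  | nil => rfl
  | cons i l ih => simp only [CL, List.foldr_cons, n_C h] at ih ⊢; rw [ih]
theorem n_infL (h : DHom ⟨_, S⟩ ⟨_, S'⟩ f) (l) : f (S.infL l) = S'.infL (l.map f) := by
  induction l with
  | nil => exact n_top h
  | cons i l ih => simp only [infL, List.foldr_cons, List.map_cons, n_inf h] at ih ⊢; rw [ih]
theorem n_bin (h : DHom ⟨_, S⟩ ⟨_, S'⟩ f) (x : A) : f (S.bin x) = S'.bin (f x) := n_CL h _ _
theorem n_sb (h : DHom ⟨_, S⟩ ⟨_, S'⟩ f) (i j) (x : A) : f (S.sb i j x) = S'.sb i j (f x) := by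
  simp only [sb, n_C h, n_inf h, n_diag h]
theorem n_comp (h : DHom ⟨_, S⟩ ⟨_, S'⟩ f) (x y : A) : f (S.comp x y) = S'.comp (f x) (f y) := by
  simp only [comp, n_C h, n_inf h, n_sb h]
theorem n_conv (h : DHom ⟨_, S⟩ ⟨_, S'⟩ f) (x : A) : f (S.conv x) = S'.conv (f x) := by
  simp only [conv, n_sb h]
theorem n_one (h : DHom ⟨_, S⟩ ⟨_, S'⟩ f) : f S.one = S'.one := n_diag h _ _
theorem n_uniq (h : DHom ⟨_, S⟩ ⟨_, S'⟩ f) (T : A → A) (T' : B → B) (hT : ∀ x, f (T x) = T' (f x)) :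
    f (S.uniq T) = S'.uniq T' := by
  simp only [uniq, n_C h, n_inf h, n_compl h, hT, n_diag h]
theorem n_sing (h : DHom ⟨_, S⟩ ⟨_, S'⟩ f) : f S.sing = S'.sing := n_uniq h _ _ (n_cylu h 0)
theorem n_nn (h : DHom ⟨_, S⟩ ⟨_, S'⟩ f) : f S.nn = S'.nn := by
  simp only [nn, n_C h, n_sup h, n_compl h, n_sing h, n_diag h]
theorem n_path0 (h : DHom ⟨_, S⟩ ⟨_, S'⟩ f) (x : A) : f (S.path0 x) = S'.path0 (f x) := by
  simp only [path0, n_inf h, n_sing h, n_cylu h]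
theorem n_path1 (h : DHom ⟨_, S⟩ ⟨_, S'⟩ f) (x : A) : f (S.path1 x) = S'.path1 (f x) := by
  simp only [path1, n_inf h, n_nn h, n_cylu h, n_path0 h]
theorem n_tot (h : DHom ⟨_, S⟩ ⟨_, S'⟩ f) (T : A → A) (T' : B → B) (hT : ∀ x, f (T x) = T' (f x))
    (x : A) : f (S.tot T x) = S'.tot T' (f x) := by
  simp only [tot, n_sup h, n_inf h, n_compl h, hT, n_uniq h T T' hT]
theorem n_p (h : DHom ⟨_, S⟩ ⟨_, S'⟩ f) : f S.p = S'.p := by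
  simp only [p, n_tot h _ _ (n_path0 h), n_diag h]
theorem n_q (h : DHom ⟨_, S⟩ ⟨_, S'⟩ f) : f S.q = S'.q := by
  simp only [q, n_tot h _ _ (n_path1 h), n_diag h]
theorem n_r (h : DHom ⟨_, S⟩ ⟨_, S'⟩ f) : f S.r = S'.r := by
  simp only [r, n_cyld h, n_diag h]
theorem n_qs (h : DHom ⟨_, S⟩ ⟨_, S'⟩ f) (k : ℕ) : f (S.qs k) = S'.qs k := by
  induction k with
  | zero => exact n_p h
  | succ k ih => simp only [qs, n_comp h, n_q h, ih]
theorem n_atc (h : DHom ⟨_, S⟩ ⟨_, S'⟩ f) (i) (x : A) : f (S.atc i x) = S'.atc i (f x) := by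
  unfold atc; split_ifs <;> simp only [n_sb h]
theorem n_hat (h : DHom ⟨_, S⟩ ⟨_, S'⟩ f) (x : A) : f (S.hat x) = S'.hat (f x) := by
  simp only [hat, n_CL h, n_inf h, n_tot h _ _ (n_path0 h), n_infL h, List.map_map,
    Function.comp_def, n_atc h, n_qs h]
theorem n_agr (h : DHom ⟨_, S⟩ ⟨_, S'⟩ f) (l) : f (S.agr l) = S'.agr l := by
  simp only [agr, n_infL h, List.map_map, Function.comp_def, n_comp h, n_conv h, n_qs h]
theorem n_agx (h : DHom ⟨_, S⟩ ⟨_, S'⟩ f) (i) : f (S.agx i) = S'.agx i := n_agr h _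

theorem n_axs (h : DHom ⟨_, S⟩ ⟨_, S'⟩ f) (x y z : A) :
    (S.axs x y z).map (Prod.map f f) = S'.axs (f x) (f y) (f z) := by
  simp only [axs, axBA, axBin, axRA, axHat, axD, axU, axL, leq, List.map_append, List.map_cons,
    List.map_nil, Prod.map_apply, List.map_flatMap, List.map_map, Function.comp_def, extT, pairT,
    n_inf h, n_compl h, n_cylu h, n_cyld h, n_diag h, n_sup h, n_top h, n_bot h, n_CL h, n_bin h,
    n_comp h, n_conv h, n_one h, n_p h, n_q h, n_r h, n_qs h, n_hat h, n_agr h, n_agx h]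

end nat

/-- the term algebra -/
def TS (m : ℕ) : DSig (m+3) (DTerm (m+3)) where
  inf := .inf
  compl := .compl
  cylu := .cylu
  cyld := .cyld
  diag := .diag

end DSig

def EE (m : ℕ) : List (DTerm (m+3) × DTerm (m+3)) :=
  (DSig.TS m).axs (.var 0) (.var 1) (.var 2)

theorem eval_hom {m : ℕ} (A : DAlg (m+3)) (v : ℕ → A.carrier) :
    DHom ⟨_, DSig.TS m⟩ ⟨_, A.str⟩ (DTerm.eval A v) :=
  ⟨fun _ _ => rfl, fun _ => rfl, fun _ _ => rfl, fun _ _ => rfl, fun _ _ => rfl⟩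

theorem sat_iff {m : ℕ} (A : DAlg (m+3)) :
    (∀ e ∈ EE m, SatisfiesEq A e) ↔ A.str.Models := by
  constructor
  · intro h x y z e he
    let v : ℕ → A.carrier := fun i => if i = 0 then x else if i = 1 then y else z
    have hn := DSig.n_axs (eval_hom A v) (.var 0) (.var 1) (.var 2)
    have hv : (A.str.axs x y z) = A.str.axs (DTerm.eval A v (.var 0)) (DTerm.eval A v (.var 1))
      (DTerm.eval A v (.var 2)) := by simp [DTerm.eval, v]
    rw [hv, ← hn, List.mem_map] at he
    obtain ⟨e', he', rfl⟩ := he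
    exact h e' he' v
  · intro h e he v
    have hn := DSig.n_axs (eval_hom A v) (.var 0) (.var 1) (.var 2)
    have : Prod.map (DTerm.eval A v) (DTerm.eval A v) e ∈ A.str.axs (DTerm.eval A v (.var 0))
      (DTerm.eval A v (.var 1)) (DTerm.eval A v (.var 2)) := by
      rw [← hn]; exact List.mem_map_of_mem he
    exact h _ _ _ _ this

theorem models_of_inj {m : ℕ} {A B : DAlg (m+3)} {f : A.carrier → B.carrier}
    (hf : Function.Injective f) (h : DHom A B f) (hB : B.str.Models) : A.str.Models := by
  intro x y z e he
  apply hf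
  have hn := DSig.n_axs (S := A.str) (S' := B.str) h x y z
  have : Prod.map f f e ∈ B.str.axs (f x) (f y) (f z) := by
    rw [← hn]; exact List.mem_map_of_mem he
  exact hB _ _ _ _ this

theorem models_of_surj {m : ℕ} {A B : DAlg (m+3)} {f : A.carrier → B.carrier}
    (hf : Function.Surjective f) (h : DHom A B f) (hB : A.str.Models) : B.str.Models := by
  intro x y z e he
  obtain ⟨x, rfl⟩ := hf x
  obtain ⟨y, rfl⟩ := hf y
  obtain ⟨z, rfl⟩ := hf z
  rw [← DSig.n_axs (S := A.str) (S' := B.str) h x y z, List.mem_map] at he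
  obtain ⟨e', he', rfl⟩ := he
  exact congrArg f (hB _ _ _ _ he')

theorem models_prod {m : ℕ} {ι : Type} (B : ι → DAlg (m+3)) (hB : ∀ i, (B i).str.Models) :
    (prodDAlg B).str.Models := by
  intro x y z e he
  funext i
  have h : DHom (prodDAlg B) (B i) (fun x => x i) :=
    ⟨fun _ _ => rfl, fun _ => rfl, fun _ _ => rfl, fun _ _ => rfl, fun _ _ => rfl⟩
  have hn := DSig.n_axs (S := (prodDAlg B).str) (S' := (B i).str) h x y z
  have : Prod.map (fun x : (prodDAlg B).carrier => x i) (fun x => x i) e ∈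
      (B i).str.axs (x i) (y i) (z i) := by
    rw [← hn]; exact List.mem_map_of_mem he
  exact hB i _ _ _ _ this

theorem fz1 {m : ℕ} : (0 : Fin (m+3)) ≠ 1 := by simp [Fin.ext_iff]
theorem fz2 {m : ℕ} : (0 : Fin (m+3)) ≠ 2 := by
  rw [Ne, Fin.ext_iff]; exact (by decide : ¬ (0 = 2))
theorem f12 {m : ℕ} : (1 : Fin (m+3)) ≠ 2 := by
  rw [Ne, Fin.ext_iff]; exact (by decide : ¬ (1 = 2))
theorem f10 {m : ℕ} : (1 : Fin (m+3)) ≠ 0 := fz1.symm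
theorem f20 {m : ℕ} : (2 : Fin (m+3)) ≠ 0 := fz2.symm
theorem f21 {m : ℕ} : (2 : Fin (m+3)) ≠ 1 := f12.symm

/-- the structure of the full set algebra -/
def fstr (m : ℕ) (U : Type) (R : U → U → Prop) : DSig (m+3) (Set (Fin (m+3) → U)) :=
  (fullDAlg (m+3) U R).str

namespace fstr
variable {m : ℕ} {U : Type} {R : U → U → Prop}

/-- set of sequences defined by a binary relation on the first two coordinates -/
def rel (m : ℕ) {U : Type} (ρ : U → U → Prop) : Set (Fin (m+3) → U) := {s | ρ (s 0) (s 1)}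

theorem s_inf (X Y : Set (Fin (m+3) → U)) : (fstr m U R).inf X Y = X ∩ Y := rfl
theorem s_compl (X : Set (Fin (m+3) → U)) : (fstr m U R).compl X = Xᶜ := rfl
theorem s_diag (i j) : (fstr m U R).diag i j = {s | s i = s j} := rfl
theorem s_sup (X Y : Set (Fin (m+3) → U)) : (fstr m U R).sup X Y = X ∪ Y := by
  simp only [DSig.sup, s_inf, s_compl, Set.compl_inter, compl_compl]
theorem s_top : (fstr m U R).top = Set.univ := by
  simp only [DSig.top, s_diag, Set.setOf_true]
theorem s_bot : (fstr m U R).bot = ∅ := by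
  simp only [DSig.bot, s_top, s_compl, Set.compl_univ]

theorem upd_iff (s z : Fin (m+3) → U) (i) : (∀ j, j ≠ i → s j = z j) ↔ z = Function.update s i (z i) := by
  constructor
  · intro h; funext j
    by_cases hj : j = i
    · subst hj; simp
    · simp [hj, h j hj]
  · intro h j hj
    rw [h]; simp [hj]

theorem s_cylu (i) (X : Set (Fin (m+3) → U)) :
    (fstr m U R).cylu i X = {s | ∃ y, R y (s i) ∧ Function.update s i y ∈ X} := by
  ext s
  change (∃ z ∈ X, R (z i) (s i) ∧ ∀ j : Fin (m+3), j ≠ i → s j = z j) ↔ _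
  constructor
  · rintro ⟨z, hz, hR, h⟩
    rw [upd_iff] at h
    exact ⟨z i, hR, h ▸ hz⟩
  · rintro ⟨y, hR, h⟩
    refine ⟨_, h, by simpa using hR, ?_⟩
    intro j hj; simp [hj]

theorem s_cyld (i) (X : Set (Fin (m+3) → U)) :
    (fstr m U R).cyld i X = {s | ∃ y, R (s i) y ∧ Function.update s i y ∈ X} := by
  ext s
  change (∃ z ∈ X, R (s i) (z i) ∧ ∀ j : Fin (m+3), j ≠ i → s j = z j) ↔ _
  constructor
  · rintro ⟨z, hz, hR, h⟩
    rw [upd_iff] at h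
    exact ⟨z i, hR, h ▸ hz⟩
  · rintro ⟨y, hR, h⟩
    refine ⟨_, h, by simpa using hR, ?_⟩
    intro j hj; simp [hj]

theorem s_C (hP : IsPStruct U R) (i) (X : Set (Fin (m+3) → U)) :
    (fstr m U R).C i X = {s | ∃ y, Function.update s i y ∈ X} := by
  ext s
  simp only [DSig.C, s_cylu, s_cyld, Set.mem_ofPred_eq, Function.update_self, Function.update_idem]
  constructor
  · rintro ⟨_, _, z, _, h⟩; exact ⟨z, h⟩
  · rintro ⟨z, h⟩
    obtain ⟨c, hc⟩ := hP (s i) z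
    exact ⟨c, (hc _).2 (Or.inl rfl), z, (hc _).2 (Or.inr rfl), h⟩

theorem s_CL (hP : IsPStruct U R) (l) (X : Set (Fin (m+3) → U)) :
    (fstr m U R).CL l X = {s | ∃ z ∈ X, ∀ j, j ∉ l → z j = s j} := by
  induction l with
  | nil =>
    ext s
    simp only [DSig.CL, List.foldr_nil, Set.mem_ofPred_eq, List.not_mem_nil, not_false_eq_true,
      true_imp_iff]
    exact ⟨fun h => ⟨s, h, fun _ => rfl⟩, fun ⟨z, hz, h⟩ => (funext h : z = s) ▸ hz⟩
  | cons i l ih =>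
    have : (fstr m U R).CL (i :: l) X = (fstr m U R).C i ((fstr m U R).CL l X) := rfl
    rw [this, ih, s_C hP]
    ext s
    simp only [Set.mem_ofPred_eq, List.mem_cons, not_or]
    constructor
    · rintro ⟨y, z, hz, h⟩
      refine ⟨z, hz, fun j hj => ?_⟩
      rw [h j hj.2]; simp [hj.1]
    · rintro ⟨z, hz, h⟩
      refine ⟨z i, z, hz, fun j hj => ?_⟩
      by_cases hji : j = i
      · subst hji; simp
      · simp [hji, h j ⟨hji, hj⟩]

theorem s_sb (hP : IsPStruct U R) {i j : Fin (m+3)} (hij : i ≠ j) (X : Set (Fin (m+3) → U)) :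
    (fstr m U R).sb i j X = {s | Function.update s i (s j) ∈ X} := by
  ext s
  simp only [DSig.sb, s_C hP, s_inf, s_diag, Set.mem_ofPred_eq, Set.mem_inter_iff,
    Function.update_self, Function.update_of_ne hij.symm, exists_eq_left]

theorem b_inf (ρ σ : U → U → Prop) :
    (fstr m U R).inf (rel m ρ) (rel m σ) = rel m (fun x y => ρ x y ∧ σ x y) := rfl
theorem b_compl (ρ : U → U → Prop) :
    (fstr m U R).compl (rel m ρ) = rel m (fun x y => ¬ ρ x y) := rfl
theorem b_one : (fstr m U R).one = rel m (fun x y => x = y) := rfl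
theorem b_top : (fstr m U R).top = rel m (fun _ _ => True) := by rw [s_top]; rfl
theorem b_bot : (fstr m U R).bot = rel m (fun _ _ => False) := by rw [s_bot]; rfl
theorem b_sup (ρ σ : U → U → Prop) :
    (fstr m U R).sup (rel m ρ) (rel m σ) = rel m (fun x y => ρ x y ∨ σ x y) := by rw [s_sup]; rfl
theorem b_comp (hP : IsPStruct U R) (ρ σ : U → U → Prop) :
    (fstr m U R).comp (rel m ρ) (rel m σ) = rel m (fun x y => ∃ z, ρ x z ∧ σ z y) := by
  ext s
  simp only [DSig.comp, s_C hP, s_sb hP f12, s_sb hP fz2, s_inf, rel, Set.mem_ofPred_eq,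
    Set.mem_inter_iff, Function.update_self, Function.update_of_ne fz1, Function.update_of_ne fz2,
    Function.update_of_ne f10, Function.update_of_ne f12]
theorem b_conv (hP : IsPStruct U R) (ρ : U → U → Prop) :
    (fstr m U R).conv (rel m ρ) = rel m (fun x y => ρ y x) := by
  ext s
  simp only [DSig.conv, s_sb hP f21, s_sb hP f10, s_sb hP fz2, rel, Set.mem_ofPred_eq,
    Function.update_self, Function.update_of_ne fz1, Function.update_of_ne fz2,
    Function.update_of_ne f10, Function.update_of_ne f12, Function.update_of_ne f21]
theorem b_r : (fstr m U R).r = rel m R := by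
  ext s
  simp only [DSig.r, s_cyld, s_diag, rel, Set.mem_ofPred_eq, Function.update_self,
    Function.update_of_ne f10, exists_eq_right]

theorem s_bin (hP : IsPStruct U R) (X : Set (Fin (m+3) → U)) :
    (fstr m U R).bin X = rel m (fun x y => ∃ z ∈ X, z 0 = x ∧ z 1 = y) := by
  ext s
  simp only [DSig.bin, s_CL hP, rel, Set.mem_ofPred_eq, List.mem_filter, List.mem_finRange,
    true_and, decide_eq_true_eq]
  refine exists_congr fun z => and_congr_right fun _ => ⟨fun h => ⟨h 0 (by simp), h 1 (by simp)⟩, ?_⟩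
  intro h j hj
  by_cases h0 : j = 0
  · subst h0; exact h.1
  by_cases h1 : j = 1
  · subst h1; exact h.2
  exact absurd ⟨h0, h1⟩ hj

theorem b_bin (hP : IsPStruct U R) (ρ : U → U → Prop) :
    (fstr m U R).bin (rel m ρ) = rel m ρ := by
  rw [s_bin hP]
  ext s
  simp only [rel, Set.mem_ofPred_eq]
  constructor
  · rintro ⟨z, h, h0, h1⟩; rwa [h0, h1] at h
  · intro h; exact ⟨s, h, rfl, rfl⟩

theorem b_infL {α : Type} (l : List α) (ρ : α → U → U → Prop) :
    (fstr m U R).infL (l.map (fun j => rel m (ρ j))) = rel m (fun x y => ∀ j ∈ l, ρ j x y) := by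
  induction l with
  | nil => simp only [List.map_nil, List.not_mem_nil, false_imp_iff, implies_true]; exact b_top
  | cons i l ih =>
    have : (fstr m U R).infL ((i :: l).map (fun j => rel m (ρ j))) =
      (fstr m U R).inf (rel m (ρ i)) ((fstr m U R).infL (l.map (fun j => rel m (ρ j)))) := rfl
    rw [this, ih, b_inf]
    simp only [List.forall_mem_cons]

theorem mem_infL (l : List (Set (Fin (m+3) → U))) (s) :
    s ∈ (fstr m U R).infL l ↔ ∀ X ∈ l, s ∈ X := by
  induction l with
  | nil =>
    have : (fstr m U R).infL [] = (fstr m U R).top := rfl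
    rw [this, s_top]; simp
  | cons X l ih =>
    have : (fstr m U R).infL (X :: l) = X ∩ ((fstr m U R).infL l) := rfl
    rw [this, Set.mem_inter_iff, ih, List.forall_mem_cons]

def IsPath (T : Set (Fin (m+3) → U) → Set (Fin (m+3) → U)) (ρ : U → U → Prop) : Prop :=
  ∀ X, T X = {s | ∃ y, ρ (s 0) y ∧ Function.update s 0 y ∈ X}

open Classical in
noncomputable def tf (ρ : U → U → Prop) (w : U) : U := if h : ∃! y, ρ w y then h.choose else w

theorem tf_eq {ρ : U → U → Prop} {w y : U} (h : ρ w y) (h' : ∀ z, ρ w z → z = y) : tf ρ w = y := by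
  have hu : ∃! y, ρ w y := ⟨y, h, h'⟩
  unfold tf
  rw [dif_pos hu]
  exact h' _ hu.choose_spec.1

theorem s_uniq (hP : IsPStruct U R) {T : Set (Fin (m+3) → U) → Set (Fin (m+3) → U)}
    {ρ : U → U → Prop} (hT : IsPath T ρ) : (fstr m U R).uniq T = {s | ∃! y, ρ (s 0) y} := by
  ext s
  simp only [DSig.uniq, s_C hP, hT _, s_inf, s_compl, s_diag, Set.mem_ofPred_eq, Set.mem_inter_iff,
    Set.mem_compl_iff, Function.update_self, Function.update_of_ne fz1, Function.update_of_ne fz2,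
    Function.update_of_ne f10, Function.update_of_ne f20, Function.update_of_ne f12,
    Function.update_of_ne f21]
  constructor
  · rintro ⟨⟨y, z, h, rfl⟩, h'⟩
    refine ⟨z, h, fun z' hz' => ?_⟩
    by_contra hne
    exact h' ⟨z, z', ⟨z, h, rfl⟩, ⟨z', hz', rfl⟩, fun e => hne e.symm⟩
  · rintro ⟨y, h, h'⟩
    refine ⟨⟨y, y, h, rfl⟩, ?_⟩
    rintro ⟨a, b, ⟨_, h1, rfl⟩, ⟨_, h2, rfl⟩, hne⟩
    exact hne ((h' _ h1).trans (h' _ h2).symm)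

theorem s_tot (hP : IsPStruct U R) {T : Set (Fin (m+3) → U) → Set (Fin (m+3) → U)}
    {ρ : U → U → Prop} (hT : IsPath T ρ) (X) :
    (fstr m U R).tot T X = {s | Function.update s 0 (tf ρ (s 0)) ∈ X} := by
  ext s
  simp only [DSig.tot, s_sup, s_inf, s_compl, s_uniq hP hT, hT X, Set.mem_union, Set.mem_inter_iff,
    Set.mem_compl_iff, Set.mem_ofPred_eq]
  by_cases hu : ∃! y, ρ (s 0) y
  · obtain ⟨y, h, h'⟩ := id hu
    rw [tf_eq h h']
    constructor
    · rintro (⟨_, z, hz, hX⟩ | ⟨h, _⟩)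
      · rwa [h' z hz] at hX
      · exact absurd hu h
    · intro hX; exact Or.inl ⟨hu, y, h, hX⟩
  · have : tf ρ (s 0) = s 0 := by unfold tf; rw [dif_neg hu]
    rw [this, Function.update_eq_self]
    tauto

def Sg (R : U → U → Prop) (x : U) : Prop := ∃! y, R y x
def Nn (R : U → U → Prop) (x : U) : Prop := ¬ Sg R x ∨ ∀ a b : U, a = b
def pa0 (R : U → U → Prop) (w y : U) : Prop := ∃ z, R z w ∧ Sg R z ∧ R y z
def pa1 (R : U → U → Prop) (w y : U) : Prop := ∃ z, R z w ∧ Nn R z ∧ pa0 R z y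

theorem path_up : IsPath ((fstr m U R).cylu 0) (fun w y => R y w) := fun X => s_cylu 0 X

theorem s_sing (hP : IsPStruct U R) : (fstr m U R).sing = {s | Sg R (s 0)} := s_uniq hP path_up

theorem s_nn (hP : IsPStruct U R) : (fstr m U R).nn = {s | Nn R (s 0)} := by
  ext s
  simp only [DSig.nn, s_sup, s_compl, s_C hP, s_sing hP, s_diag, Set.mem_union, Set.mem_compl_iff,
    Set.mem_ofPred_eq, Nn, Function.update_self, Function.update_of_ne fz1, not_exists, not_not]

theorem path_0 (hP : IsPStruct U R) : IsPath ((fstr m U R).path0) (pa0 R) := by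
  intro X; ext s
  simp only [DSig.path0, s_cylu, s_inf, s_sing hP, Set.mem_ofPred_eq, Set.mem_inter_iff,
    Function.update_self, Function.update_idem, pa0]
  constructor
  · rintro ⟨z, h, h1, y, h2, h3⟩; exact ⟨y, ⟨z, h, h1, h2⟩, h3⟩
  · rintro ⟨y, ⟨z, h, h1, h2⟩, h3⟩; exact ⟨z, h, h1, y, h2, h3⟩

theorem path_1 (hP : IsPStruct U R) : IsPath ((fstr m U R).path1) (pa1 R) := by
  intro X; ext s
  simp only [DSig.path1, s_cylu, s_inf, s_nn hP, path_0 hP X, Set.mem_ofPred_eq, Set.mem_inter_iff,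
    Function.update_self, Function.update_idem, pa1]
  constructor
  · rintro ⟨z, h, h1, y, h2, h3⟩; exact ⟨y, ⟨z, h, h1, h2⟩, h3⟩
  · rintro ⟨y, ⟨z, h, h1, h2⟩, h3⟩; exact ⟨z, h, h1, y, h2, h3⟩

noncomputable def pf (R : U → U → Prop) : U → U := tf (pa0 R)
noncomputable def qf (R : U → U → Prop) : U → U := tf (pa1 R)

theorem b_p (hP : IsPStruct U R) : (fstr m U R).p = rel m (fun x y => pf R x = y) := by
  ext s
  simp only [DSig.p, s_tot hP (path_0 hP), s_diag, rel, Set.mem_ofPred_eq, Function.update_self,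
    Function.update_of_ne f10, pf]
theorem b_q (hP : IsPStruct U R) : (fstr m U R).q = rel m (fun x y => qf R x = y) := by
  ext s
  simp only [DSig.q, s_tot hP (path_1 hP), s_diag, rel, Set.mem_ofPred_eq, Function.update_self,
    Function.update_of_ne f10, qf]

theorem pair_surj (hP : IsPStruct U R) (x y : U) : ∃ w, pf R w = x ∧ qf R w = y := by
  by_cases ht : ∀ a b : U, a = b
  · exact ⟨x, ht _ _, ht _ _⟩
  · have ht' := ht
    push Not at ht'
    obtain ⟨a, b, hab⟩ := ht'
    obtain ⟨d, hd⟩ := hP a b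
    obtain ⟨sx, hsx⟩ := hP x x
    obtain ⟨sy, hsy⟩ := hP y y
    obtain ⟨k, hk⟩ := hP sy d
    obtain ⟨w, hw⟩ := hP sx k
    have h1 : Sg R sx := ⟨x, (hsx x).2 (Or.inl rfl), fun z hz => by simpa using (hsx z).1 hz⟩
    have h2 : Sg R sy := ⟨y, (hsy y).2 (Or.inl rfl), fun z hz => by simpa using (hsy z).1 hz⟩
    have h3 : ¬ Sg R d := by
      rintro ⟨z, _, hz⟩
      exact hab ((hz a ((hd a).2 (Or.inl rfl))).trans (hz b ((hd b).2 (Or.inr rfl))).symm)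
    have h4 : ¬ Sg R k := by
      rintro ⟨z, _, hz⟩
      have : sy = d := (hz sy ((hk _).2 (Or.inl rfl))).trans (hz d ((hk _).2 (Or.inr rfl))).symm
      exact h3 (this ▸ h2)
    have hkk : ∀ z, pa0 R k z ↔ z = y := by
      intro z
      constructor
      · rintro ⟨t, ht1, ht2, ht3⟩
        rcases (hk t).1 ht1 with rfl | rfl
        · simpa using (hsy z).1 ht3
        · exact absurd ht2 h3
      · rintro rfl
        exact ⟨sy, (hk _).2 (Or.inl rfl), h2, (hsy _).2 (Or.inl rfl)⟩
    refine ⟨w, tf_eq ?_ ?_, tf_eq ?_ ?_⟩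
    · exact ⟨sx, (hw _).2 (Or.inl rfl), h1, (hsx _).2 (Or.inl rfl)⟩
    · rintro z ⟨t, ht1, ht2, ht3⟩
      rcases (hw t).1 ht1 with rfl | rfl
      · simpa using (hsx z).1 ht3
      · exact absurd ht2 h4
    · exact ⟨k, (hw _).2 (Or.inr rfl), Or.inl h4, (hkk _).2 rfl⟩
    · rintro z ⟨t, ht1, ht2, ht3⟩
      rcases (hw t).1 ht1 with rfl | rfl
      · rcases ht2 with ht2 | ht2
        · exact absurd h1 ht2
        · exact absurd ht2 ht
      · exact (hkk _).1 ht3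

noncomputable def Qf (R : U → U → Prop) : ℕ → U → U
  | 0, x => pf R x
  | k+1, x => Qf R k (qf R x)

theorem b_qs (hP : IsPStruct U R) (k : ℕ) :
    (fstr m U R).qs k = rel m (fun x y => Qf R k x = y) := by
  induction k with
  | zero => exact b_p hP
  | succ k ih =>
    simp only [DSig.qs, ih, b_q hP, b_comp hP, Qf, exists_eq_left']

theorem tuple_surj (hP : IsPStruct U R) (k : ℕ) : ∀ (x : ℕ → U), ∃ w, ∀ i < k, Qf R i w = x i := by
  induction k with
  | zero => intro x; exact ⟨x 0, by simp⟩
  | succ k ih =>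
    intro x
    obtain ⟨w, hw⟩ := ih (fun i => x (i+1))
    obtain ⟨w', h1, h2⟩ := pair_surj hP (x 0) w
    refine ⟨w', fun i hi => ?_⟩
    cases i with
    | zero => exact h1
    | succ i => simp only [Qf, h2]; exact hw i (by omega)

theorem tuple_surj' (hP : IsPStruct U R) (x : Fin (m+3) → U) :
    ∃ w, ∀ i : Fin (m+3), Qf R i w = x i := by
  obtain ⟨w, hw⟩ := tuple_surj hP (m+3) (fun i => if h : i < m+3 then x ⟨i, h⟩ else x 0)
  refine ⟨w, fun i => ?_⟩
  rw [hw i i.2, dif_pos i.2]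

theorem s_atc (hP : IsPStruct U R) (i : Fin (m+3)) (hi : i ≠ 0) (ρ : U → U → Prop) :
    (fstr m U R).atc i (rel m ρ) = {s | ρ (s 0) (s i)} := by
  unfold DSig.atc
  split_ifs with h
  · subst h; rfl
  · rw [s_sb hP (Ne.symm h)]
    ext s
    simp only [rel, Set.mem_ofPred_eq, Function.update_self, Function.update_of_ne fz1]

def hrel (R : U → U → Prop) (X : Set (Fin (m+3) → U)) : U → U → Prop :=
  fun x _ => (fun i : Fin (m+3) => Qf R i x) ∈ X

theorem b_hat (hP : IsPStruct U R) (X : Set (Fin (m+3) → U)) :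
    (fstr m U R).hat X = rel m (hrel R X) := by
  ext s
  simp only [DSig.hat, s_CL hP, s_inf, s_tot hP (path_0 hP), rel, Set.mem_ofPred_eq,
    Set.mem_inter_iff, mem_infL, List.mem_map, List.mem_filter, List.mem_finRange, true_and,
    decide_eq_true_eq, not_not, forall_exists_index, and_imp, forall_apply_eq_imp_iff₂, hrel, b_qs hP]
  have key : ∀ z : Fin (m+3) → U, (∀ i : Fin (m+3), i ≠ 0 → Qf R i (z 0) = z i) →
      Function.update z 0 (tf (pa0 R) (z 0)) = fun i : Fin (m+3) => Qf R i (z 0) := by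
    intro z hz
    funext i
    by_cases hi : i = 0
    · subst hi; simp [Qf, pf]
    · simp [hi, hz i hi]
  constructor
  · rintro ⟨z, ⟨h1, h2⟩, h3⟩
    have h4 : ∀ i : Fin (m+3), i ≠ 0 → Qf R i (z 0) = z i := by
      intro i hi
      have := h2 i hi
      rwa [show {s : Fin (m+3) → U | Qf R i (s 0) = s 1} = rel m (fun x y => Qf R i x = y) from rfl, s_atc hP i hi] at this
    rw [key z h4, h3 0 rfl] at h1
    exact h1
  · intro h
    let z : Fin (m+3) → U := fun i => if i = 0 then s 0 else Qf R i (s 0)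
    have hz0 : z 0 = s 0 := by simp [z]
    have hz : ∀ i : Fin (m+3), i ≠ 0 → Qf R i (z 0) = z i := by
      intro i hi; rw [hz0]; simp [z, hi]
    refine ⟨z, ⟨?_, ?_⟩, ?_⟩
    · rw [key z hz, hz0]; exact h
    · intro i hi
      rw [show {s : Fin (m+3) → U | Qf R i (s 0) = s 1} = rel m (fun x y => Qf R i x = y) from rfl, s_atc hP i hi]
      exact hz i hi
    · rintro j rfl; exact hz0

theorem b_agr (hP : IsPStruct U R) (l : List (Fin (m+3))) :
    (fstr m U R).agr l = rel m (fun x y => ∀ j : Fin (m+3), j ∈ l → Qf R j x = Qf R j y) := by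
  unfold DSig.agr
  simp only [b_qs hP, b_conv hP, b_comp hP, b_infL, exists_eq_left']
  ext s; simp only [rel, Set.mem_ofPred_eq, eq_comm]

end fstr

namespace fstr
variable {m : ℕ} {U : Type} {R : U → U → Prop}

theorem rel_congr {ρ σ : U → U → Prop} (h : ∀ x y, ρ x y ↔ σ x y) : rel m ρ = rel m σ := by
  ext s; exact h _ _

theorem rel_le {ρ σ : U → U → Prop} (h : ∀ x y, ρ x y → σ x y) :
    (fstr m U R).sup (rel m ρ) (rel m σ) = rel m σ := by
  rw [b_sup]
  exact rel_congr fun x y => ⟨fun h' => h'.elim (h x y) id, Or.inr⟩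

theorem sound_BA (X Y Z : Set (Fin (m+3) → U)) :
    ∀ e ∈ (fstr m U R).axBA X Y Z, e.1 = e.2 := by
  simp only [DSig.axBA, List.forall_mem_cons, List.not_mem_nil, false_imp_iff, implies_true,
    and_true, s_inf, s_sup, s_compl, s_top, s_bot]
  refine ⟨?_, ?_, ?_, ?_, ?_, ?_, ?_, ?_, ?_, ?_, ?_⟩
  all_goals
    ext s
    simp only [Set.mem_union, Set.mem_inter_iff, Set.mem_compl_iff, Set.mem_univ,
      Set.mem_empty_iff_false]
    tauto

theorem sound_Bin (hP : IsPStruct U R) (X : Set (Fin (m+3) → U)) (ρ σ : U → U → Prop) :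
    ∀ e ∈ (fstr m U R).axBin X (rel m ρ) (rel m σ), e.1 = e.2 := by
  simp only [DSig.axBin, List.forall_mem_cons, List.not_mem_nil, false_imp_iff, implies_true,
    and_true, b_inf, b_compl, b_comp hP, b_conv hP, b_p hP, b_q hP, b_r, b_hat hP, b_top, b_one,
    b_bin hP]
  refine ⟨trivial, trivial, ?_⟩
  rw [s_bin hP X, b_bin hP]

theorem sound_RA (hP : IsPStruct U R) (ρ σ τ : U → U → Prop) :
    ∀ e ∈ (fstr m U R).axRA (rel m ρ) (rel m σ) (rel m τ), e.1 = e.2 := by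
  simp only [DSig.axRA, DSig.leq, List.forall_mem_cons, List.not_mem_nil, false_imp_iff,
    implies_true,
    and_true, b_inf, b_compl, b_comp hP, b_conv hP, b_p hP, b_q hP, b_r, b_top, b_bot, b_one, b_sup]
  refine ⟨?_, ?_, ?_, ?_, ?_, ?_, ?_, ?_, ?_, ?_, ?_, ?_, ?_, ?_, ?_, ?_, ?_⟩
  all_goals try exact trivial
  all_goals
    apply rel_congr
    intro x y
  · grind
  · grind
  · grind
  · grind
  · grind
  · grind
  · grind
  · grind
  · grind
  · grind
  · grind
  · grind
  · grind
  · grind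
  · have := pair_surj hP x y
    grind

theorem sound_Hat (hP : IsPStruct U R) (hE : IsExtensional U R) (X Y : Set (Fin (m+3) → U)) :
    ∀ e ∈ (fstr m U R).axHat X Y, e.1 = e.2 := by
  simp only [DSig.axHat, DSig.leq, List.forall_mem_cons, List.not_mem_nil, false_imp_iff,
    implies_true, and_true]
  refine ⟨?_, ?_, ?_, ?_, ?_, ?_, ?_, ?_⟩
  · simp only [b_hat hP, b_inf]; rfl
  · simp only [b_hat hP, b_compl]; rfl
  · simp only [b_hat hP, b_agr hP, b_comp hP]
    apply rel_le
    rintro x y ⟨z, h1, h2⟩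
    have : (fun i : Fin (m+3) => Qf R i x) = (fun i : Fin (m+3) => Qf R i z) :=
      funext fun i => h1 i (List.mem_finRange i)
    unfold hrel at *
    rwa [this]
  · simp only [b_hat hP, b_one, b_inf, b_top, b_comp hP]
    apply rel_congr
    intro x y
    simp [hrel]
  · rw [b_hat hP, s_CL hP, s_sup]
    apply Set.union_eq_right.2
    intro s hs
    obtain ⟨w, hw⟩ := tuple_surj' hP s
    refine ⟨fun _ => w, ?_, fun j hj => absurd (List.mem_finRange j) hj⟩
    change (fun i : Fin (m+3) => Qf R i w) ∈ X
    rwa [funext hw]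
  · rw [s_bot, s_CL hP]
    ext s; simp
  · simp only [DSig.extT, b_r, b_one, b_compl, b_conv hP, b_comp hP, b_sup, b_top]
    apply rel_congr
    intro x y
    simp only [iff_true]
    by_contra h
    push Not at h
    apply h.2
    apply hE
    intro z
    have h1 := h.1.1 z
    have h2 := h.1.2 z
    tauto
  · simp only [DSig.pairT, b_r, b_one, b_compl, b_conv hP, b_comp hP, b_sup, b_top, b_inf, b_p hP,
      b_q hP]
    apply rel_congr
    intro x y
    obtain ⟨c, hc⟩ := hP (pf R x) (qf R x)
    simp only [iff_true, and_true]
    refine ⟨c, ⟨_, rfl, (hc _).2 (Or.inl rfl)⟩, ⟨_, rfl, (hc _).2 (Or.inr rfl)⟩, ?_⟩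
    rintro ⟨z, ⟨⟨_, rfl, h1⟩, ⟨_, rfl, h2⟩⟩, h3⟩
    rcases (hc _).1 h3 with h | h
    · exact h1 h.symm
    · exact h2 h.symm

theorem sound_D (hP : IsPStruct U R) (i j : Fin (m+3)) :
    ((fstr m U R).axD i j).1 = ((fstr m U R).axD i j).2 := by
  simp only [DSig.axD, b_hat hP, b_qs hP, b_one, b_inf, b_conv hP, b_comp hP, b_top]
  apply rel_congr
  intro x y
  simp only [hrel, s_diag, Set.mem_ofPred_eq, and_true]
  constructor
  · intro h; exact ⟨x, rfl, _, rfl, h.symm⟩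
  · rintro ⟨_, rfl, _, h1, h2⟩; exact h1.trans h2.symm

theorem upd_q (R : U → U → Prop) {i : Fin (m+3)} {x z : U}
    (h : ∀ j : Fin (m+3), j ∈ (List.finRange (m+3)).filter (fun j => j ≠ i) → Qf R j x = Qf R j z) :
    Function.update (fun j : Fin (m+3) => Qf R j x) i (Qf R i z) =
      (fun j : Fin (m+3) => Qf R j z) := by
  funext j
  by_cases hj : j = i
  · subst hj; simp
  · simp only [Function.update_of_ne hj]
    exact h j (by simp [hj])

theorem upd_ex (hP : IsPStruct U R) (i : Fin (m+3)) (x y : U) : ∃ z,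
    (∀ j : Fin (m+3), j ∈ (List.finRange (m+3)).filter (fun j => j ≠ i) → Qf R j x = Qf R j z) ∧
    Qf R i z = y := by
  obtain ⟨z, hz⟩ := tuple_surj' hP (Function.update (fun j : Fin (m+3) => Qf R j x) i y)
  refine ⟨z, fun j hj => ?_, by simp [hz i]⟩
  have : j ≠ i := by simpa using hj
  rw [hz j, Function.update_of_ne this]

theorem sound_U (hP : IsPStruct U R) (X : Set (Fin (m+3) → U)) (i : Fin (m+3)) :
    ((fstr m U R).axU X i).1 = ((fstr m U R).axU X i).2 := by
  simp only [DSig.axU, DSig.agx, b_agr hP, b_r, b_hat hP, b_qs hP, b_one, b_inf, b_conv hP,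
    b_comp hP, b_top]
  apply rel_congr
  intro x y
  simp only [hrel, s_cylu, Set.mem_ofPred_eq]
  constructor
  · rintro ⟨w, h1, h2⟩
    obtain ⟨z, hz, rfl⟩ := upd_ex hP i x w
    rw [upd_q R hz] at h2
    exact ⟨z, ⟨hz, _, ⟨_, rfl, h1⟩, rfl⟩, h2⟩
  · rintro ⟨z, ⟨hz, _, ⟨_, rfl, h1⟩, rfl⟩, h2⟩
    refine ⟨_, h1, ?_⟩
    rwa [upd_q R hz]

theorem sound_L (hP : IsPStruct U R) (X : Set (Fin (m+3) → U)) (i : Fin (m+3)) :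
    ((fstr m U R).axL X i).1 = ((fstr m U R).axL X i).2 := by
  simp only [DSig.axL, DSig.agx, b_agr hP, b_r, b_hat hP, b_qs hP, b_one, b_inf, b_conv hP,
    b_comp hP, b_top]
  apply rel_congr
  intro x y
  simp only [hrel, s_cyld, Set.mem_ofPred_eq]
  constructor
  · rintro ⟨w, h1, h2⟩
    obtain ⟨z, hz, rfl⟩ := upd_ex hP i x w
    rw [upd_q R hz] at h2
    exact ⟨z, ⟨hz, _, ⟨_, rfl, h1⟩, rfl⟩, h2⟩
  · rintro ⟨z, ⟨hz, _, ⟨_, rfl, h1⟩, rfl⟩, h2⟩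
    refine ⟨_, h1, ?_⟩
    rwa [upd_q R hz]

theorem sound (hP : IsPStruct U R) (hE : IsExtensional U R) : (fstr m U R).Models := by
  intro X Y Z e he
  simp only [DSig.axs, List.mem_append, List.mem_flatMap, List.mem_map, List.mem_finRange,
    true_and] at he
  rcases he with (((((he | he) | he) | he) | ⟨i, j, rfl⟩) | ⟨i, rfl⟩) | ⟨i, rfl⟩
  · exact sound_BA _ _ _ e he
  · rw [s_bin hP X, s_bin hP Y] at he
    exact sound_Bin hP _ _ _ e he
  · rw [s_bin hP X, s_bin hP Y, s_bin hP Z] at he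
    exact sound_RA hP _ _ _ e he
  · exact sound_Hat hP hE _ _ e he
  · exact sound_D hP i j
  · exact sound_U hP X i
  · exact sound_L hP X i

end fstr

theorem models_of_RCAup {m : ℕ} {A : DAlg (m+3)} (hA : A ∈ RCAup (m+3)) : A.str.Models := by
  obtain ⟨ι, B, hB, f, hf, hh⟩ := hA
  refine models_of_inj hf hh (models_prod B fun i => ?_)
  obtain ⟨U, R, hP, hE, g, hg, hgh⟩ := hB i
  exact models_of_inj hg hgh (fstr.sound hP hE)

/-- a Boolean algebra from equational axioms -/
@[reducible] def mkBA {K : Type} (su nf : K → K → K) (co : K → K) (tp bo : K)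
    (h1 : ∀ x y, su x y = su y x) (h2 : ∀ x y z, su (su x y) z = su x (su y z))
    (h3 : ∀ x y, nf x y = nf y x) (h4 : ∀ x y z, nf (nf x y) z = nf x (nf y z))
    (h5 : ∀ x y, su x (nf x y) = x) (h6 : ∀ x y, nf x (su x y) = x)
    (h7 : ∀ x y z, nf (su x y) (su x z) = su x (nf y z))
    (h8 : ∀ x, nf x (co x) = bo) (h9 : ∀ x, su x (co x) = tp)
    (h10 : ∀ x, su x tp = tp) (h11 : ∀ x, su bo x = x) : BooleanAlgebra K :=
  letI : Max K := ⟨su⟩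
  letI : Min K := ⟨nf⟩
  letI l : Lattice K := Lattice.mk' h1 h2 h3 h4 h5 h6
  letI d : DistribLattice K := { l with le_sup_inf := fun x y z => le_of_eq (h7 x y z) }
  { d with
    compl := co
    top := tp
    bot := bo
    inf_compl_le_bot := fun x => le_of_eq (h8 x)
    top_le_sup_compl := fun x => le_of_eq (h9 x).symm
    le_top := fun x => h10 x
    bot_le := fun x => h11 x }

namespace DSig
variable {m : ℕ} {A : Type} {S : DSig (m+3) A}

theorem Models.BA (h : S.Models) (x y z : A) : ∀ e ∈ S.axBA x y z, e.1 = e.2 :=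
  fun e he => h x y z e (by simp only [axs, List.mem_append]; tauto)
theorem Models.Bin (h : S.Models) (x y : A) : ∀ e ∈ S.axBin x (S.bin x) (S.bin y), e.1 = e.2 :=
  fun e he => h x y x e (by simp only [axs, List.mem_append]; tauto)
theorem Models.RA (h : S.Models) (x y z : A) :
    ∀ e ∈ S.axRA (S.bin x) (S.bin y) (S.bin z), e.1 = e.2 :=
  fun e he => h x y z e (by simp only [axs, List.mem_append]; tauto)
theorem Models.Hat (h : S.Models) (x y : A) : ∀ e ∈ S.axHat x y, e.1 = e.2 :=
  fun e he => h x y x e (by simp only [axs, List.mem_append]; tauto)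
theorem Models.D (h : S.Models) (i j : Fin (m+3)) : (S.axD i j).1 = (S.axD i j).2 :=
  h S.top S.top S.top _ (by
    simp only [axs, List.mem_append, List.mem_flatMap, List.mem_map, List.mem_finRange, true_and]
    exact Or.inl (Or.inl (Or.inr ⟨i, j, rfl⟩)))
theorem Models.Up (h : S.Models) (x : A) (i : Fin (m+3)) : (S.axU x i).1 = (S.axU x i).2 :=
  h x x x _ (by
    simp only [axs, List.mem_append, List.mem_flatMap, List.mem_map, List.mem_finRange, true_and]
    exact Or.inl (Or.inr ⟨i, rfl⟩))
theorem Models.Dn (h : S.Models) (x : A) (i : Fin (m+3)) : (S.axL x i).1 = (S.axL x i).2 :=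
  h x x x _ (by
    simp only [axs, List.mem_append, List.mem_flatMap, List.mem_map, List.mem_finRange, true_and]
    exact Or.inr ⟨i, rfl⟩)

variable (S) in
def BB (x : A) : Prop := S.bin x = x

theorem Models.RA' (h : S.Models) {x y z : A} (hx : S.BB x) (hy : S.BB y) (hz : S.BB z) :
    ∀ e ∈ S.axRA x y z, e.1 = e.2 := by
  have := h.RA x y z
  rwa [hx, hy, hz] at this
theorem Models.Bin' (h : S.Models) {x y : A} (hx : S.BB x) (hy : S.BB y) :
    ∀ e ∈ S.axBin x x y, e.1 = e.2 := by
  have := h.Bin x y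
  rwa [hx, hy] at this

theorem Models.Ba (h : S.Models) (x y z : A) :
    (S.sup x y = S.sup y x) ∧
    (S.sup (S.sup x y) z = S.sup x (S.sup y z)) ∧
    (S.inf x y = S.inf y x) ∧
    (S.inf (S.inf x y) z = S.inf x (S.inf y z)) ∧
    (S.sup x (S.inf x y) = x) ∧
    (S.inf x (S.sup x y) = x) ∧
    (S.inf (S.sup x y) (S.sup x z) = S.sup x (S.inf y z)) ∧
    (S.inf x (S.compl x) = S.bot) ∧
    (S.sup x (S.compl x) = S.top) ∧
    (S.sup x S.top = S.top) ∧
    (S.sup S.bot x = x) := by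
  have := h.BA x y z
  simp only [axBA, List.forall_mem_cons, List.not_mem_nil, false_imp_iff, implies_true,
    and_true] at this
  exact this

theorem Bbin (h : S.Models) (x : A) : S.BB (S.bin x) := by
  have := h.Bin x x
  simp only [axBin, List.forall_mem_cons] at this
  exact this.2.2.1
theorem Binf (h : S.Models) {x y : A} (hx : S.BB x) (hy : S.BB y) : S.BB (S.inf x y) := by
  have := h.Bin' hx hy
  simp only [axBin, List.forall_mem_cons] at this
  exact this.1
theorem Bcompl (h : S.Models) {x : A} (hx : S.BB x) : S.BB (S.compl x) := by
  have := h.Bin' hx hx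
  simp only [axBin, List.forall_mem_cons] at this
  exact this.2.1
theorem Bcomp (h : S.Models) {x y : A} (hx : S.BB x) (hy : S.BB y) : S.BB (S.comp x y) := by
  have := h.Bin' hx hy
  simp only [axBin, List.forall_mem_cons] at this
  exact this.2.2.2.1
theorem Bconv (h : S.Models) {x : A} (hx : S.BB x) : S.BB (S.conv x) := by
  have := h.Bin' hx hx
  simp only [axBin, List.forall_mem_cons] at this
  exact this.2.2.2.2.1
theorem Bc (h : S.Models) : S.BB S.one ∧ S.BB S.p ∧ S.BB S.q ∧ S.BB S.r ∧ S.BB S.top ∧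
    ∀ x, S.BB (S.hat x) := by
  have h1 : ∀ x, _ := fun x => h.Bin x x
  simp only [axBin, List.forall_mem_cons] at h1
  have := (h1 S.top).2.2.2.2.2
  exact ⟨this.1, this.2.1, this.2.2.1, this.2.2.2.1, this.2.2.2.2.1,
    fun x => (h1 x).2.2.2.2.2.2.2.2.2.2.1⟩
theorem Bone (h : S.Models) : S.BB S.one := (Bc h).1
theorem Bp (h : S.Models) : S.BB S.p := (Bc h).2.1
theorem Bq (h : S.Models) : S.BB S.q := (Bc h).2.2.1
theorem Br (h : S.Models) : S.BB S.r := (Bc h).2.2.2.1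
theorem Btop (h : S.Models) : S.BB S.top := (Bc h).2.2.2.2.1
theorem Bhat (h : S.Models) (x) : S.BB (S.hat x) := (Bc h).2.2.2.2.2 x
theorem Bbot (h : S.Models) : S.BB S.bot := Bcompl h (Btop h)
theorem Bsup (h : S.Models) {x y : A} (hx : S.BB x) (hy : S.BB y) : S.BB (S.sup x y) :=
  Bcompl h (Binf h (Bcompl h hx) (Bcompl h hy))
theorem Bqs (h : S.Models) (k : ℕ) : S.BB (S.qs k) := by
  induction k with
  | zero => exact Bp h
  | succ k ih => exact Bcomp h (Bq h) ih

@[reducible] def baK (h : S.Models) : BooleanAlgebra {x : A // S.BB x} :=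
  mkBA (fun x y => ⟨S.sup x.1 y.1, Bsup h x.2 y.2⟩) (fun x y => ⟨S.inf x.1 y.1, Binf h x.2 y.2⟩)
    (fun x => ⟨S.compl x.1, Bcompl h x.2⟩) ⟨S.top, Btop h⟩ ⟨S.bot, Bbot h⟩
    (fun x y => Subtype.ext (h.Ba x.1 y.1 y.1).1)
    (fun x y z => Subtype.ext (h.Ba x.1 y.1 z.1).2.1)
    (fun x y => Subtype.ext (h.Ba x.1 y.1 y.1).2.2.1)
    (fun x y z => Subtype.ext (h.Ba x.1 y.1 z.1).2.2.2.1)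
    (fun x y => Subtype.ext (h.Ba x.1 y.1 y.1).2.2.2.2.1)
    (fun x y => Subtype.ext (h.Ba x.1 y.1 y.1).2.2.2.2.2.1)
    (fun x y z => Subtype.ext (h.Ba x.1 y.1 z.1).2.2.2.2.2.2.1)
    (fun x => Subtype.ext (h.Ba x.1 x.1 x.1).2.2.2.2.2.2.2.1)
    (fun x => Subtype.ext (h.Ba x.1 x.1 x.1).2.2.2.2.2.2.2.2.1)
    (fun x => Subtype.ext (h.Ba x.1 x.1 x.1).2.2.2.2.2.2.2.2.2.1)
    (fun x => Subtype.ext (h.Ba x.1 x.1 x.1).2.2.2.2.2.2.2.2.2.2)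

@[reducible] def baA (h : S.Models) : BooleanAlgebra A :=
  mkBA S.sup S.inf S.compl S.top S.bot
    (fun x y => (h.Ba x y y).1)
    (fun x y z => (h.Ba x y z).2.1)
    (fun x y => (h.Ba x y y).2.2.1)
    (fun x y z => (h.Ba x y z).2.2.2.1)
    (fun x y => (h.Ba x y y).2.2.2.2.1)
    (fun x y => (h.Ba x y y).2.2.2.2.2.1)
    (fun x y z => (h.Ba x y z).2.2.2.2.2.2.1)
    (fun x => (h.Ba x x x).2.2.2.2.2.2.2.1)
    (fun x => (h.Ba x x x).2.2.2.2.2.2.2.2.1)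
    (fun x => (h.Ba x x x).2.2.2.2.2.2.2.2.2.1)
    (fun x => (h.Ba x x x).2.2.2.2.2.2.2.2.2.2)

theorem Models.Ra (h : S.Models) {a b c : A} (ha : S.BB a) (hb : S.BB b) (hc : S.BB c) :
    (S.comp (S.comp a b) c = S.comp a (S.comp b c)) ∧
    (S.comp S.one a = a) ∧
    (S.comp a S.one = a) ∧
    (S.conv (S.conv a) = a) ∧
    (S.conv (S.comp a b) = S.comp (S.conv b) (S.conv a)) ∧
    (S.conv (S.inf a b) = S.inf (S.conv a) (S.conv b)) ∧
    (S.comp a (S.sup b c) = S.sup (S.comp a b) (S.comp a c)) ∧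
    (S.comp (S.sup b c) a = S.sup (S.comp b a) (S.comp c a)) ∧
    (S.comp a S.bot = S.bot) ∧
    (S.comp S.bot a = S.bot) ∧
    (S.sup (S.inf (S.comp a b) c) (S.comp a (S.inf b (S.comp (S.conv a) c))) = (S.comp a (S.inf b (S.comp (S.conv a) c)))) ∧
    (S.sup (S.inf (S.comp a b) c) (S.comp (S.inf a (S.comp c (S.conv b))) b) = (S.comp (S.inf a (S.comp c (S.conv b))) b)) ∧
    (S.sup (S.comp (S.conv S.p) S.p) S.one = S.one) ∧
    (S.sup S.one (S.comp S.p (S.conv S.p)) = (S.comp S.p (S.conv S.p))) ∧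
    (S.sup (S.comp (S.conv S.q) S.q) S.one = S.one) ∧
    (S.sup S.one (S.comp S.q (S.conv S.q)) = (S.comp S.q (S.conv S.q))) ∧
    (S.comp (S.conv S.p) S.q = S.top) := by
  have := h.RA' ha hb hc
  simp only [axRA, leq, List.forall_mem_cons, List.not_mem_nil, false_imp_iff, implies_true,
    and_true] at this
  exact this

theorem Models.Ha (h : S.Models) (x y : A) :
    (S.hat (S.inf x y) = S.inf (S.hat x) (S.hat y)) ∧
    (S.hat (S.compl x) = S.compl (S.hat x)) ∧
    (S.sup (S.comp (S.agr (List.finRange (m+3))) (S.hat x)) (S.hat x) = (S.hat x)) ∧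
    (S.hat x = S.comp (S.inf S.one (S.hat x)) S.top) ∧
    (S.sup x (S.CL (List.finRange (m+3)) (S.hat x)) = (S.CL (List.finRange (m+3)) (S.hat x))) ∧
    (S.CL (List.finRange (m+3)) S.bot = S.bot) ∧
    (S.sup S.extT S.one = S.top) ∧
    (S.comp S.pairT S.top = S.top) := by
  have := h.Hat x y
  simp only [axHat, leq, List.forall_mem_cons, List.not_mem_nil, false_imp_iff, implies_true,
    and_true] at this
  exact this

def QK (h : S.Models) : @QRA {x : A // S.BB x} (baK h) :=
  letI := baK h
  { comp := fun x y => ⟨S.comp x.1 y.1, Bcomp h x.2 y.2⟩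
    conv := fun x => ⟨S.conv x.1, Bconv h x.2⟩
    one := ⟨S.one, Bone h⟩
    p := ⟨S.p, Bp h⟩
    q := ⟨S.q, Bq h⟩
    assoc := fun x y z => Subtype.ext (h.Ra x.2 y.2 z.2).1
    one_comp := fun x => Subtype.ext (h.Ra x.2 x.2 x.2).2.1
    comp_one := fun x => Subtype.ext (h.Ra x.2 x.2 x.2).2.2.1
    conv_conv := fun x => Subtype.ext (h.Ra x.2 x.2 x.2).2.2.2.1
    conv_comp := fun x y => Subtype.ext (h.Ra x.2 y.2 x.2).2.2.2.2.1
    conv_inf := fun x y => Subtype.ext (h.Ra x.2 y.2 x.2).2.2.2.2.2.1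
    comp_sup := fun x y z => Subtype.ext (h.Ra x.2 y.2 z.2).2.2.2.2.2.2.1
    sup_comp := fun x y z => Subtype.ext (h.Ra x.2 y.2 z.2).2.2.2.2.2.2.2.1
    comp_bot := fun x => Subtype.ext (h.Ra x.2 x.2 x.2).2.2.2.2.2.2.2.2.1
    bot_comp := fun x => Subtype.ext (h.Ra x.2 x.2 x.2).2.2.2.2.2.2.2.2.2.1
    mod1 := fun x y z => Subtype.ext (h.Ra x.2 y.2 z.2).2.2.2.2.2.2.2.2.2.2.1
    mod2 := fun x y z => Subtype.ext (h.Ra x.2 y.2 z.2).2.2.2.2.2.2.2.2.2.2.2.1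
    pfun := Subtype.ext (h.Ra (Bp h) (Bp h) (Bp h)).2.2.2.2.2.2.2.2.2.2.2.2.1
    ptot := Subtype.ext (h.Ra (Bp h) (Bp h) (Bp h)).2.2.2.2.2.2.2.2.2.2.2.2.2.1
    qfun := Subtype.ext (h.Ra (Bp h) (Bp h) (Bp h)).2.2.2.2.2.2.2.2.2.2.2.2.2.2.1
    qtot := Subtype.ext (h.Ra (Bp h) (Bp h) (Bp h)).2.2.2.2.2.2.2.2.2.2.2.2.2.2.2.1
    pq := Subtype.ext (h.Ra (Bp h) (Bp h) (Bp h)).2.2.2.2.2.2.2.2.2.2.2.2.2.2.2.2 }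

/-- relational representation of the binary elements -/
structure Rp (S : DSig (m+3) A) {U : Type} (ρ : A → U → U → Prop) : Prop where
  inf : ∀ a b, S.BB a → S.BB b → ∀ x y, ρ (S.inf a b) x y ↔ ρ a x y ∧ ρ b x y
  compl : ∀ a, S.BB a → ∀ x y, ρ (S.compl a) x y ↔ ¬ ρ a x y
  conv : ∀ a, S.BB a → ∀ x y, ρ (S.conv a) x y ↔ ρ a y x
  one : ∀ x y, ρ S.one x y ↔ x = y
  comp : ∀ a b, S.BB a → S.BB b → ∀ x y, ρ (S.comp a b) x y ↔ ∃ z, ρ a x z ∧ ρ b z y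

theorem b0_ne (h : S.Models) {a : A} (ha : a ≠ S.bot) : S.inf S.one (S.hat a) ≠ S.bot := by
  intro h0
  obtain ⟨-, -, -, h1, h2, h3, -, -⟩ := h.Ha a a
  rw [h0, (h.Ra (Btop h) (Btop h) (Btop h)).2.2.2.2.2.2.2.2.2.1] at h1
  rw [h1, h3] at h2
  apply ha
  rw [← h2, (h.Ba a S.bot a).1]
  exact ((h.Ba a a a).2.2.2.2.2.2.2.2.2.2).symm

theorem exists_Rp (h : S.Models) {a : A} (ha : a ≠ S.bot) :
    ∃ (U : Type) (ρ : A → U → U → Prop), S.Rp ρ ∧ ∃ u, ρ (S.hat a) u u := by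
  letI := baK h
  have hB := Binf h (Bone h) (Bhat h a)
  have hle : (⟨S.inf S.one (S.hat a), hB⟩ : {x : A // S.BB x}) ≤ (QK h).one :=
    (inf_le_left : (⟨S.one, Bone h⟩ : {x : A // S.BB x}) ⊓ ⟨S.hat a, Bhat h a⟩ ≤ _)
  obtain ⟨U, H, ⟨u, hu⟩, hi, hc, hv, ho, hm⟩ := (QK h).exists_rep ⟨_, hB⟩
    (fun e => b0_ne h ha (congrArg Subtype.val e)) hle
  have key : ∀ a (hb : S.BB a), H ⟨S.bin a, Bbin h a⟩ = H ⟨a, hb⟩ := by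
    intro a hb; congr 1; exact Subtype.ext hb
  refine ⟨U, fun a => H ⟨S.bin a, Bbin h a⟩, ⟨?_, ?_, ?_, ?_, ?_⟩, u, ?_⟩
  · intro a b ha hb x y
    rw [key _ (Binf h ha hb), key _ ha, key _ hb]; exact hi ⟨a, ha⟩ ⟨b, hb⟩ x y
  · intro a ha x y
    rw [key _ (Bcompl h ha), key _ ha]; exact hc ⟨a, ha⟩ x y
  · intro a ha x y
    rw [key _ (Bconv h ha), key _ ha]; exact hv ⟨a, ha⟩ x y
  · intro x y
    rw [key _ (Bone h)]; exact ho x y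
  · intro a b ha hb x y
    rw [key _ (Bcomp h ha hb), key _ ha, key _ hb]; exact hm ⟨a, ha⟩ ⟨b, hb⟩ x y
  · change H ⟨S.bin (S.hat a), Bbin h _⟩ u u
    rw [key _ (Bhat h a)]
    exact ((hi ⟨S.one, Bone h⟩ ⟨S.hat a, Bhat h a⟩ u u).1 hu).2

namespace Rp
variable {U : Type} {ρ : A → U → U → Prop}

theorem sup (P : S.Rp ρ) (h : S.Models) (a b) (ha : S.BB a) (hb : S.BB b) (x y) :
    ρ (S.sup a b) x y ↔ ρ a x y ∨ ρ b x y := by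
  unfold DSig.sup
  rw [P.compl _ (Binf h (Bcompl h ha) (Bcompl h hb)), P.inf _ _ (Bcompl h ha) (Bcompl h hb),
    P.compl _ ha, P.compl _ hb]
  tauto
theorem top (P : S.Rp ρ) (h : S.Models) (x y) : ρ S.top x y := by
  rw [← (h.Ba S.top S.top S.top).2.2.2.2.2.2.2.2.1, P.sup h _ _ (Btop h) (Bcompl h (Btop h)),
    P.compl _ (Btop h)]
  tauto
theorem le (P : S.Rp ρ) (h : S.Models) {a b} (ha : S.BB a) (hb : S.BB b) (hab : S.sup a b = b)
    {x y} (hx : ρ a x y) : ρ b x y := by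
  rw [← hab, P.sup h _ _ ha hb]; exact Or.inl hx

theorem ptot (P : S.Rp ρ) (h : S.Models) (x) : ∃ y, ρ S.p x y := by
  have := P.le h (Bone h) (Bcomp h (Bp h) (Bconv h (Bp h)))
    (h.Ra (Bp h) (Bp h) (Bp h)).2.2.2.2.2.2.2.2.2.2.2.2.2.1 ((P.one x x).2 rfl)
  rw [P.comp _ _ (Bp h) (Bconv h (Bp h))] at this
  exact this.imp fun _ h => h.1
theorem qtot (P : S.Rp ρ) (h : S.Models) (x) : ∃ y, ρ S.q x y := by
  have := P.le h (Bone h) (Bcomp h (Bq h) (Bconv h (Bq h)))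
    (h.Ra (Bp h) (Bp h) (Bp h)).2.2.2.2.2.2.2.2.2.2.2.2.2.2.2.1 ((P.one x x).2 rfl)
  rw [P.comp _ _ (Bq h) (Bconv h (Bq h))] at this
  exact this.imp fun _ h => h.1
theorem pfun (P : S.Rp ρ) (h : S.Models) {x y z} (h1 : ρ S.p x y) (h2 : ρ S.p x z) : y = z := by
  rw [← P.one]
  refine P.le h (Bcomp h (Bconv h (Bp h)) (Bp h)) (Bone h)
    (h.Ra (Bp h) (Bp h) (Bp h)).2.2.2.2.2.2.2.2.2.2.2.2.1 ?_
  rw [P.comp _ _ (Bconv h (Bp h)) (Bp h)]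
  exact ⟨x, (P.conv _ (Bp h) _ _).2 h1, h2⟩
theorem qfun (P : S.Rp ρ) (h : S.Models) {x y z} (h1 : ρ S.q x y) (h2 : ρ S.q x z) : y = z := by
  rw [← P.one]
  refine P.le h (Bcomp h (Bconv h (Bq h)) (Bq h)) (Bone h)
    (h.Ra (Bp h) (Bp h) (Bp h)).2.2.2.2.2.2.2.2.2.2.2.2.2.2.1 ?_
  rw [P.comp _ _ (Bconv h (Bq h)) (Bq h)]
  exact ⟨x, (P.conv _ (Bq h) _ _).2 h1, h2⟩
theorem pq (P : S.Rp ρ) (h : S.Models) (x y) : ∃ w, ρ S.p w x ∧ ρ S.q w y := by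
  have := P.top h x y
  rw [← (h.Ra (Bp h) (Bp h) (Bp h)).2.2.2.2.2.2.2.2.2.2.2.2.2.2.2.2,
    P.comp _ _ (Bconv h (Bp h)) (Bq h)] at this
  exact this.imp fun w hw => ⟨(P.conv _ (Bp h) _ _).1 hw.1, hw.2⟩

theorem qs_succ (P : S.Rp ρ) (h : S.Models) (k : ℕ) (x y) :
    ρ (S.qs (k+1)) x y ↔ ∃ z, ρ S.q x z ∧ ρ (S.qs k) z y := P.comp _ _ (Bq h) (Bqs h k) x y
theorem qstot (P : S.Rp ρ) (h : S.Models) (k : ℕ) : ∀ x, ∃ y, ρ (S.qs k) x y := by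
  induction k with
  | zero => exact P.ptot h
  | succ k ih =>
    intro x
    obtain ⟨z, hz⟩ := P.qtot h x
    obtain ⟨y, hy⟩ := ih z
    exact ⟨y, (P.qs_succ h k x y).2 ⟨z, hz, hy⟩⟩
theorem qsfun (P : S.Rp ρ) (h : S.Models) (k : ℕ) :
    ∀ {x y z}, ρ (S.qs k) x y → ρ (S.qs k) x z → y = z := by
  induction k with
  | zero => exact P.pfun h
  | succ k ih =>
    intro x y z h1 h2
    obtain ⟨w, hw, h1⟩ := (P.qs_succ h k _ _).1 h1
    obtain ⟨w', hw', h2⟩ := (P.qs_succ h k _ _).1 h2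
    obtain rfl := P.qfun h hw hw'
    exact ih h1 h2
theorem tuple (P : S.Rp ρ) (h : S.Models) (k : ℕ) :
    ∀ x : ℕ → U, ∃ w, ∀ i < k, ρ (S.qs i) w (x i) := by
  induction k with
  | zero => intro x; exact ⟨x 0, by simp⟩
  | succ k ih =>
    intro x
    obtain ⟨w, hw⟩ := ih (fun i => x (i+1))
    obtain ⟨w', h1, h2⟩ := P.pq h (x 0) w
    refine ⟨w', fun i hi => ?_⟩
    cases i with
    | zero => exact h1
    | succ i => exact (P.qs_succ h i _ _).2 ⟨w, h2, hw i (by omega)⟩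
theorem tuple' (P : S.Rp ρ) (h : S.Models) (x : Fin (m+3) → U) :
    ∃ w, ∀ i : Fin (m+3), ρ (S.qs i) w (x i) := by
  obtain ⟨w, hw⟩ := P.tuple h (m+3) (fun i => if h : i < m+3 then x ⟨i, h⟩ else x 0)
  refine ⟨w, fun i => ?_⟩
  have := hw i i.2
  rwa [dif_pos i.2] at this

theorem isP (P : S.Rp ρ) (h : S.Models) : IsPStruct U (ρ S.r) := by
  intro a b
  obtain ⟨w, hp, hq⟩ := P.pq h a b
  have hr := Br h
  have h1 := Bcomp h (Bp h) hr
  have h2 := Bcomp h (Bq h) hr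
  have no := Bcompl h (Bone h)
  have h3 := Bcomp h (Bp h) no
  have h4 := Bcomp h (Bq h) no
  have h5 := Binf h h3 h4
  have h6 := Bcomp h h5 hr
  have h7 := Bcompl h h6
  have h8 := Binf h h2 h7
  have h9 : S.BB S.pairT := Binf h h1 h8
  have ht := P.top h w w
  rw [← (h.Ha S.top S.top).2.2.2.2.2.2.2, P.comp _ _ h9 (Btop h)] at ht
  obtain ⟨c, hc, -⟩ := ht
  unfold pairT at hc
  rw [P.inf _ _ h1 h8, P.inf _ _ h2 h7, P.compl _ h6, P.comp _ _ (Bp h) hr,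
    P.comp _ _ (Bq h) hr, P.comp _ _ h5 hr] at hc
  obtain ⟨⟨a', ha', hac⟩, ⟨b', hb', hbc⟩, hn⟩ := hc
  obtain rfl := P.pfun h ha' hp
  obtain rfl := P.qfun h hb' hq
  refine ⟨c, fun d => ⟨fun hd => ?_, ?_⟩⟩
  · by_contra hne
    push Not at hne
    apply hn
    refine ⟨d, ?_, hd⟩
    rw [P.inf _ _ h3 h4, P.comp _ _ (Bp h) no, P.comp _ _ (Bq h) no]
    exact ⟨⟨_, hp, (P.compl _ (Bone h) _ _).2 fun e => hne.1 ((P.one _ _).1 e).symm⟩,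
      ⟨_, hq, (P.compl _ (Bone h) _ _).2 fun e => hne.2 ((P.one _ _).1 e).symm⟩⟩
  · rintro (rfl | rfl)
    · exact hac
    · exact hbc

theorem isE (P : S.Rp ρ) (h : S.Models) : IsExtensional U (ρ S.r) := by
  intro a b hab
  have hr := Br h
  have hv := Bconv h hr
  have h1 := Bcomp h hv (Bcompl h hr)
  have h2 := Bcomp h (Bcompl h hv) hr
  have ht := P.top h a b
  rw [← (h.Ha S.top S.top).2.2.2.2.2.2.1, P.sup h S.extT _ (Bsup h h1 h2) (Bone h)] at ht
  unfold extT at ht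
  rw [P.sup h _ _ h1 h2, P.comp _ _ hv (Bcompl h hr), P.comp _ _ (Bcompl h hv) hr, P.one] at ht
  rcases ht with (⟨z, hz1, hz2⟩ | ⟨z, hz1, hz2⟩) | ht
  · rw [P.conv _ hr] at hz1
    rw [P.compl _ hr] at hz2
    exact absurd ((hab z).1 hz1) hz2
  · rw [P.compl _ hv, P.conv _ hr] at hz1
    exact absurd ((hab z).2 hz2) hz1
  · exact ht

theorem BinfL (h : S.Models) {α : Type} (l : List α) (g : α → A) (hg : ∀ j, S.BB (g j)) :
    S.BB (S.infL (l.map g)) := by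
  induction l with
  | nil => exact Btop h
  | cons i l ih => exact Binf h (hg i) ih
theorem infL (P : S.Rp ρ) (h : S.Models) {α : Type} (l : List α) (g : α → A)
    (hg : ∀ j, S.BB (g j)) (x y) : ρ (S.infL (l.map g)) x y ↔ ∀ j ∈ l, ρ (g j) x y := by
  induction l with
  | nil => exact ⟨fun _ _ hj => absurd hj List.not_mem_nil, fun _ => P.top h x y⟩
  | cons i l ih =>
    rw [List.forall_mem_cons, ← ih]
    exact P.inf _ _ (hg i) (BinfL h l g hg) x y

theorem Bagr (h : S.Models) (l : List (Fin (m+3))) : S.BB (S.agr l) :=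
  BinfL h l _ fun j => Bcomp h (Bqs h j) (Bconv h (Bqs h j))
theorem agr (P : S.Rp ρ) (h : S.Models) (l : List (Fin (m+3))) (x y) :
    ρ (S.agr l) x y ↔ ∀ j : Fin (m+3), j ∈ l → ∃ z, ρ (S.qs j) x z ∧ ρ (S.qs j) y z := by
  unfold DSig.agr
  rw [P.infL h l _ fun j => Bcomp h (Bqs h j) (Bconv h (Bqs h j))]
  refine forall₂_congr fun j _ => ?_
  rw [P.comp _ _ (Bqs h j) (Bconv h (Bqs h j))]
  simp only [P.conv _ (Bqs h j)]

theorem vec (P : S.Rp ρ) (h : S.Models) (a z w w') (hw : ρ (S.hat a) z w) : ρ (S.hat a) z w' := by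
  have hi := Binf h (Bone h) (Bhat h a)
  rw [(h.Ha a a).2.2.2.1, P.comp _ _ hi (Btop h)] at hw ⊢
  exact hw.imp fun t ht => ⟨ht.1, P.top h _ _⟩

theorem wd (P : S.Rp ρ) (h : S.Models) (a) {z w} {s : Fin (m+3) → U}
    (hz : ∀ i : Fin (m+3), ρ (S.qs i) z (s i)) (hw : ∀ i : Fin (m+3), ρ (S.qs i) w (s i))
    (hh : ρ (S.hat a) w w) : ρ (S.hat a) z z := by
  have ha := Bagr h (List.finRange (m+3))
  refine P.vec h a z w z (P.le h (Bcomp h ha (Bhat h a)) (Bhat h a) (h.Ha a a).2.2.1 ?_)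
  rw [P.comp _ _ ha (Bhat h a)]
  exact ⟨w, (P.agr h _ _ _).2 fun j _ => ⟨s j, hz j, hw j⟩, hh⟩

variable (S ρ) in
def hm (a : A) : Set (Fin (m+3) → U) :=
  {s | ∃ z, (∀ i : Fin (m+3), ρ (S.qs i) z (s i)) ∧ ρ (S.hat a) z z}

theorem mem_hm (P : S.Rp ρ) (h : S.Models) {a z} {s : Fin (m+3) → U}
    (hz : ∀ i : Fin (m+3), ρ (S.qs i) z (s i)) : s ∈ hm S ρ a ↔ ρ (S.hat a) z z :=
  ⟨fun ⟨_, hw, hh⟩ => P.wd h a hz hw hh, fun hh => ⟨z, hz, hh⟩⟩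

theorem upd (P : S.Rp ρ) (h : S.Models) {i : Fin (m+3)} {z z' y} {s : Fin (m+3) → U}
    (hz : ∀ i : Fin (m+3), ρ (S.qs i) z (s i)) (ha : ρ (S.agx i) z z') (hy : ρ (S.qs i) z' y) :
    ∀ j : Fin (m+3), ρ (S.qs j) z' (Function.update s i y j) := by
  intro j
  by_cases hj : j = i
  · subst hj; simpa using hy
  · rw [Function.update_of_ne hj]
    obtain ⟨t, h1, h2⟩ := (P.agr h _ _ _).1 ha j (by simp [hj])
    rwa [P.qsfun h j (hz j) h1]

theorem upd' (P : S.Rp ρ) (h : S.Models) {i : Fin (m+3)} {z z' y} {s : Fin (m+3) → U}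
    (hz : ∀ i : Fin (m+3), ρ (S.qs i) z (s i))
    (hz' : ∀ j : Fin (m+3), ρ (S.qs j) z' (Function.update s i y j)) :
    ρ (S.agx i) z z' ∧ ρ (S.qs i) z' y := by
  refine ⟨(P.agr h _ _ _).2 fun j hj => ⟨s j, hz j, ?_⟩, by simpa using hz' i⟩
  have hj : j ≠ i := by simpa using hj
  have := hz' j
  rwa [Function.update_of_ne hj] at this

theorem step (P : S.Rp ρ) (h : S.Models) {i : Fin (m+3)} {a b : A} (hb : S.BB b)
    {z} {s : Fin (m+3) → U}
    (hz : ∀ i : Fin (m+3), ρ (S.qs i) z (s i)) :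
    ρ (S.comp (S.inf (S.agx i) (S.comp (S.comp (S.qs i) b) (S.conv (S.qs i)))) (S.hat a)) z z ↔
    ∃ y, ρ b (s i) y ∧ Function.update s i y ∈ hm S ρ a := by
  have hq := Bqs h i
  have h1 := Bcomp h hq hb
  have h2 := Bcomp h h1 (Bconv h hq)
  have h3 : S.BB (S.agx i) := Bagr h _
  rw [P.comp _ _ (Binf h h3 h2) (Bhat h a)]
  constructor
  · rintro ⟨z', hz', hh⟩
    rw [P.inf _ _ h3 h2, P.comp _ _ h1 (Bconv h hq)] at hz'
    obtain ⟨ha, y, hy1, hy2⟩ := hz'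
    rw [P.comp _ _ hq hb] at hy1
    obtain ⟨t, ht, hty⟩ := hy1
    obtain rfl := P.qsfun h i ht (hz i)
    rw [P.conv _ hq] at hy2
    exact ⟨y, hty, (P.mem_hm h (P.upd h hz ha hy2)).2 (P.vec h a _ _ _ hh)⟩
  · rintro ⟨y, hy, z', hz', hh⟩
    obtain ⟨h4, h5⟩ := P.upd' h hz hz'
    refine ⟨z', ?_, P.vec h a _ _ _ hh⟩
    rw [P.inf _ _ h3 h2, P.comp _ _ h1 (Bconv h hq)]
    refine ⟨h4, y, ?_, (P.conv _ hq _ _).2 h5⟩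
    rw [P.comp _ _ hq hb]
    exact ⟨_, hz i, hy⟩

theorem hom (P : S.Rp ρ) (h : S.Models) :
    DHom ⟨A, S⟩ (fullDAlg (m+3) U (ρ S.r)) (hm S ρ) := by
  refine ⟨fun x y => ?_, fun x => ?_, fun i x => ?_, fun i x => ?_, fun i j => ?_⟩
  all_goals
    refine Set.ext fun s => ?_
    obtain ⟨z, hz⟩ := P.tuple' h s
    refine (P.mem_hm h hz).trans ?_
  · change _ ↔ s ∈ hm S ρ x ∧ s ∈ hm S ρ y
    rw [P.mem_hm h hz, P.mem_hm h hz, ← P.inf _ _ (Bhat h x) (Bhat h y), ← (h.Ha x y).1]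
  · change _ ↔ ¬ (s ∈ hm S ρ x)
    rw [P.mem_hm h hz, ← P.compl _ (Bhat h x), ← (h.Ha x x).2.1]
  · change _ ↔ s ∈ (fstr m U (ρ S.r)).cylu i (hm S ρ x)
    rw [fstr.s_cylu]
    have := h.Up x i
    simp only [axU] at this
    change ρ (S.hat (S.cylu i x)) z z ↔ _
    rw [this, P.step h (Bconv h (Br h)) hz]
    simp only [P.conv _ (Br h)]
    rfl
  · change _ ↔ s ∈ (fstr m U (ρ S.r)).cyld i (hm S ρ x)
    rw [fstr.s_cyld]
    have := h.Dn x i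
    simp only [axL] at this
    change ρ (S.hat (S.cyld i x)) z z ↔ _
    rw [this, P.step h (Br h) hz]
    rfl
  · change _ ↔ s i = s j
    have := h.D i j
    simp only [axD] at this
    change ρ (S.hat (S.diag i j)) z z ↔ _
    have h1 := Bconv h (Bqs h j)
    have h2 := Bcomp h (Bqs h i) h1
    rw [this, P.comp _ _ (Binf h (Bone h) h2) (Btop h)]
    constructor
    · rintro ⟨t, ht, -⟩
      rw [P.inf _ _ (Bone h) h2, P.one, P.comp _ _ (Bqs h i) h1] at ht
      obtain ⟨rfl, y, hy1, hy2⟩ := ht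
      rw [P.conv _ (Bqs h j)] at hy2
      exact (P.qsfun h i (hz i) hy1).trans (P.qsfun h j hy2 (hz j))
    · intro e
      refine ⟨z, ?_, P.top h _ _⟩
      rw [P.inf _ _ (Bone h) h2, P.one, P.comp _ _ (Bqs h i) h1]
      refine ⟨rfl, s i, hz i, ?_⟩
      rw [P.conv _ (Bqs h j), e]
      exact hz j

theorem hm_ne (P : S.Rp ρ) (h : S.Models) {a u} (hu : ρ (S.hat a) u u) : (hm S ρ a).Nonempty := by
  choose s hs using fun i : Fin (m+3) => P.qstot h i u
  exact ⟨s, u, hs, hu⟩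

end Rp
end DSig

theorem CsUp_full {n : ℕ} {U : Type} {R : U → U → Prop} (hP : IsPStruct U R)
    (hE : IsExtensional U R) : fullDAlg n U R ∈ CsUp n :=
  ⟨U, R, hP, hE, id, Function.injective_id,
    fun _ _ => rfl, fun _ => rfl, fun _ _ => rfl, fun _ _ => rfl, fun _ _ => rfl⟩

theorem RCAup_of_models {m : ℕ} {A : DAlg (m+3)} (h : A.str.Models) : A ∈ RCAup (m+3) := by
  have key : ∀ a : {a : A.carrier // a ≠ A.str.bot}, ∃ B : DAlg (m+3), B ∈ CsUp (m+3) ∧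
      ∃ f : A.carrier → B.carrier, DHom A B f ∧ f a.1 ≠ f A.str.bot := by
    rintro ⟨a, ha⟩
    obtain ⟨U, ρ, P, u, hu⟩ := DSig.exists_Rp h ha
    refine ⟨_, CsUp_full (P.isP h) (P.isE h), _, P.hom h, fun e => ?_⟩
    have h1 := P.hm_ne h hu
    have h2 := DSig.n_bot (S' := fstr m U (ρ A.str.r)) (P.hom h)
    rw [fstr.s_bot] at h2
    rw [show DSig.Rp.hm A.str ρ a = ∅ from e.trans h2] at h1
    exact Set.not_nonempty_empty h1
  choose B hB f hf hne using key
  refine ⟨_, B, hB, fun x a => f a x, ?_, ?_⟩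
  · intro x y hxy
    have hxy' : ∀ a, f a x = f a y := fun a => congrFun hxy a
    letI := DSig.baA h
    have main : ∀ x y : A.carrier, (∀ a, f a x = f a y) → x ≤ y := by
      intro x y hxy
      by_contra hle
      have hn : A.str.inf x (A.str.compl y) ≠ A.str.bot := by
        intro e
        apply hle
        have e' : x ⊓ yᶜ = ⊥ := e
        rwa [← disjoint_iff, disjoint_compl_right_iff] at e'
      apply hne ⟨_, hn⟩
      have e2 : A.str.bot = A.str.inf y (A.str.compl y) := (h.Ba y y y).2.2.2.2.2.2.2.1.symm
      have hh := hf ⟨_, hn⟩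
      have e3 := congrArg (f ⟨_, hn⟩) e2
      refine Eq.trans ?_ e3.symm
      change f ⟨_, hn⟩ (A.str.inf x (A.str.compl y)) = _
      rw [hh.1, hh.1, hxy]
    exact le_antisymm (main x y hxy') (main y x fun a => (hxy' a).symm)
  · refine ⟨fun x y => ?_, fun x => ?_, fun i x => ?_, fun i x => ?_, fun i j => ?_⟩
    · exact funext fun a => (hf a).1 x y
    · exact funext fun a => (hf a).2.1 x
    · exact funext fun a => (hf a).2.2.1 i x
    · exact funext fun a => (hf a).2.2.2.1 i x
    · exact funext fun a => (hf a).2.2.2.2 i j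

theorem RCAup_iff {m : ℕ} (A : DAlg (m+3)) : A ∈ RCAup (m+3) ↔ A.str.Models :=
  ⟨models_of_RCAup, RCAup_of_models⟩

/-- For every finite `n ≥ 3`, the class `RCA↑_n` of representable directed
cylindric algebras of dimension `n` is a finitely axiomatizable variety: it is the class of
models of a finite list of equations, and it is closed under homomorphic images,
subalgebras, and products. -/
theorem RCAup_finitely_axiomatizable_variety (n : ℕ) (hn : 3 ≤ n) :
    -- finitely axiomatizable
    (∃ E : List (DTerm n × DTerm n),
      ∀ A : DAlg n, A ∈ RCAup n ↔ ∀ e ∈ E, SatisfiesEq A e) ∧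
    -- closed under homomorphic images
    (∀ A ∈ RCAup n, ∀ B : DAlg n,
      (∃ f : A.carrier → B.carrier, Function.Surjective f ∧ DHom A B f) → B ∈ RCAup n) ∧
    -- closed under subalgebras
    (∀ A ∈ RCAup n, ∀ B : DAlg n,
      (∃ f : B.carrier → A.carrier, Function.Injective f ∧ DHom B A f) → B ∈ RCAup n) ∧
    -- closed under products
    (∀ (ι : Type) (B : ι → DAlg n), (∀ i, B i ∈ RCAup n) → prodDAlg B ∈ RCAup n) := by
  obtain ⟨m, rfl⟩ : ∃ m, n = m + 3 := ⟨n - 3, by omega⟩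
  refine ⟨⟨EE m, fun A => (RCAup_iff A).trans (sat_iff A).symm⟩, ?_, ?_, ?_⟩
  · rintro A hA B ⟨f, hf, hh⟩
    exact (RCAup_iff B).2 (models_of_surj hf hh ((RCAup_iff A).1 hA))
  · rintro A hA B ⟨f, hf, hh⟩
    exact (RCAup_iff B).2 (models_of_inj hf hh ((RCAup_iff A).1 hA))
  · intro ι B hB
    exact (RCAup_iff _).2 (models_prod B fun i => (RCAup_iff _).1 (hB i))
end
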